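/- Let (R,m) be a Noetherian local ring which has a dualizing module D, let C be a semidualizing R-module, and set C' = Hom_R(C,D). Then the following statements are equivalent: (i) C' ≅ R; (ii) H_a^{ht_R(a)}(R) belongs to the Bass class B_{C'}(R) for every ideal a of R such that R is relative Cohen-Macaulay with respect to a; (iii) H_a^{ht_R(a)}(R) belongs to B_{C'}(R) for some ideal a of R such that R is relative Cohen-Macaulay with respect to a. -/

import Mathlib

/-!
Common definitions: semidualizing modules, `C`-injective modules and dimensions,
`G_C`-injective modules, Bass/Auslander classes, relative Cohen-Macaulayness,
Cohen-Macaulay and Gorenstein local rings, trivial extensions, ideal torsion.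
-/

noncomputable section

open CategoryTheory TensorProduct

universe u

variable (R : Type u) [CommRing R]

/-- An `R`-module `M` is `C`-injective if it is isomorphic to `Hom_R(C, I)`
for some injective `R`-module `I`. -/
def IsCInjective (C M : ModuleCat.{u} R) : Prop :=
  ∃ I : ModuleCat.{u} R, Module.Injective R I ∧ Nonempty (M ≃ₗ[R] (C →ₗ[R] I))

/-- `HasCoresDimLE R P n M` : the module `M` admits a coresolution of length at most `n`
by modules satisfying the property `P`. -/
def HasCoresDimLE (P : ModuleCat.{u} R → Prop) : ℕ → ModuleCat.{u} R → Prop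
  | 0, M => Subsingleton M ∨ P M
  | n + 1, M => Subsingleton M ∨ ∃ (X : ModuleCat.{u} R) (f : M →ₗ[R] X),
      P X ∧ Function.Injective f ∧
        HasCoresDimLE P n (ModuleCat.of R (X ⧸ LinearMap.range f))

/-- The coresolution dimension of `M` with respect to the class of modules satisfying `P`,
as an element of `ℕ∞` (`⊤` meaning no finite coresolution exists). -/
def coresDim (P : ModuleCat.{u} R → Prop) (M : ModuleCat.{u} R) : ℕ∞ :=
  sInf {d : ℕ∞ | ∃ n : ℕ, d = n ∧ HasCoresDimLE R P n M}

/-- The `C`-injective dimension of `M`. -/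
def cinjDim (C M : ModuleCat.{u} R) : ℕ∞ :=
  coresDim R (IsCInjective R C) M

/-- The injective dimension of `M`. -/
def injDim (M : ModuleCat.{u} R) : ℕ∞ :=
  coresDim R (fun N => Module.Injective R N) M

/-- A finitely generated `R`-module `C` is semidualizing if the natural map
`R → Hom_R(C,C)` is bijective and `Ext_R^i(C,C) = 0` for all `i ≥ 1`. -/
def IsSemidualizing (C : ModuleCat.{u} R) : Prop :=
  Module.Finite R C ∧ Function.Bijective (LinearMap.lsmul R C) ∧
    ∀ i : ℕ, 1 ≤ i →
      Subsingleton (((Ext R (ModuleCat.{u} R) i).obj (Opposite.op C)).obj C)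

/-- A dualizing module is a semidualizing module of finite injective dimension. -/
def IsDualizing (C : ModuleCat.{u} R) : Prop :=
  IsSemidualizing R C ∧ injDim R C ≠ ⊤

/-- A complete `I_C I`-resolution: an exact complex `Y` (with `d i : Y (i+1) → Y i`)
which stays exact after applying `Hom_R(I, -)` for every `C`-injective `I`, whose terms
in positive degrees are `C`-injective and whose terms in degrees `≤ 0` are injective. -/
structure CompleteICIResolution (C : ModuleCat.{u} R) where
  Y : ℤ → ModuleCat.{u} R
  d : (i : ℤ) → (Y (i + 1) →ₗ[R] Y i)
  exact : ∀ i : ℤ, Function.Exact (d (i + 1)) (d i)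
  cinj_pos : ∀ i : ℤ, 0 < i → IsCInjective R C (Y i)
  inj_nonpos : ∀ i : ℤ, i ≤ 0 → Module.Injective R (Y i)
  homExact : ∀ I : ModuleCat.{u} R, IsCInjective R C I → ∀ i : ℤ,
    Function.Exact (fun f : I →ₗ[R] Y (i + 1 + 1) => (d (i + 1)).comp f)
      (fun f : I →ₗ[R] Y (i + 1) => (d i).comp f)

/-- A module is `G_C`-injective if it is the kernel of the degree-`0` differential of some
complete `I_C I`-resolution. -/
def IsGCInjective (C M : ModuleCat.{u} R) : Prop :=
  ∃ res : CompleteICIResolution R C,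
    Nonempty (M ≃ₗ[R] ↥(LinearMap.ker (res.d (-1))))

/-- The `G_C`-injective dimension of `M`. -/
def gcinjDim (C M : ModuleCat.{u} R) : ℕ∞ :=
  coresDim R (IsGCInjective R C) M

/-- `M` is relative Cohen-Macaulay with respect to `a`: there is exactly one
non-vanishing local cohomology module of `M` with respect to `a`. -/
def IsRelativeCM (a : Ideal R) (M : ModuleCat.{u} R) : Prop :=
  ∃! n : ℕ, Nontrivial ((localCohomology a n).obj M)

/-- `M` is relative Cohen-Macaulay with respect to `a`, with (unique) non-vanishing
local cohomology in degree `n`. -/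
def IsRelativeCMAt (a : Ideal R) (n : ℕ) (M : ModuleCat.{u} R) : Prop :=
  Nontrivial ((localCohomology a n).obj M) ∧
    ∀ i : ℕ, i ≠ n → Subsingleton ((localCohomology a i).obj M)

/-- The cohomological dimension `cd(a, M)`: the largest `i` with `H_a^i(M) ≠ 0`. -/
def lcCohomDim (a : Ideal R) (M : ModuleCat.{u} R) : ℕ :=
  sSup {i : ℕ | Nontrivial ((localCohomology a i).obj M)}

/-- The grade `grade(a, M)`: the least `i` with `H_a^i(M) ≠ 0`. -/
def lcGrade (a : Ideal R) (M : ModuleCat.{u} R) : ℕ :=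
  sInf {i : ℕ | Nontrivial ((localCohomology a i).obj M)}

/-- A Noetherian local ring is Cohen-Macaulay iff `H_m^i(R) = 0` for all `i ≠ dim R`
(Grothendieck's characterization, taken here as the definition). -/
def IsCohenMacaulayLocalRing (S : Type u) [CommRing S] [IsLocalRing S] : Prop :=
  ∀ i : ℕ, (i : WithBot ℕ∞) ≠ ringKrullDim S →
    Subsingleton ((localCohomology (IsLocalRing.maximalIdeal S) i).obj (ModuleCat.of S S))

/-- A local ring is Gorenstein if it has finite injective dimension over itself. -/
def IsGorensteinLocalRing (S : Type u) [CommRing S] : Prop :=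
  injDim S (ModuleCat.of S S) ≠ ⊤

/-- The `a`-torsion submodule `Γ_a(M)` of `M`. -/
def idealTorsion (a : Ideal R) (M : Type u) [AddCommGroup M] [Module R M] :
    Submodule R M :=
  ⨆ n : ℕ, Submodule.torsionBySet R M ((a ^ n : Ideal R) : Set R)

/-- The Krull dimension of a module, `dim_S N = dim (S / ann_S N)`. -/
def moduleKrullDim (S : Type u) [CommRing S] (N : Type u) [AddCommGroup N] [Module S N] :
    WithBot ℕ∞ :=
  ringKrullDim (S ⧸ Module.annihilator S N)

/-- `ht_M(a) = inf { dim_{R_p} M_p  |  p ∈ Supp (M / a M) }`. -/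
def heightWRT (a : Ideal R) (M : Type u) [AddCommGroup M] [Module R M] : WithBot ℕ∞ :=
  ⨅ (p : PrimeSpectrum R) (_ : p ∈ Module.support R (M ⧸ (a • (⊤ : Submodule R M)))),
    moduleKrullDim (Localization.AtPrime p.asIdeal) (LocalizedModule p.asIdeal.primeCompl M)

/-- Membership in the Bass class `B_C(R)`. -/
def MemBassClass (C M : ModuleCat.{u} R) : Prop :=
  (∀ i : ℕ, 1 ≤ i →
      Subsingleton (((Ext R (ModuleCat.{u} R) i).obj (Opposite.op C)).obj M)) ∧
  (∀ i : ℕ, 1 ≤ i →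
      Subsingleton (((Tor (ModuleCat.{u} R) i).obj C).obj (ModuleCat.of R (C →ₗ[R] M)))) ∧
  Function.Bijective
    (TensorProduct.lift ((LinearMap.id : (C →ₗ[R] M) →ₗ[R] (C →ₗ[R] M)).flip))

/-- Membership in the Auslander class `A_C(R)`. -/
def MemAuslanderClass (C M : ModuleCat.{u} R) : Prop :=
  (∀ i : ℕ, 1 ≤ i →
      Subsingleton (((Tor (ModuleCat.{u} R) i).obj C).obj M)) ∧
  (∀ i : ℕ, 1 ≤ i →
      Subsingleton (((Ext R (ModuleCat.{u} R) i).obj (Opposite.op C)).obj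
        (ModuleCat.of R (↥C ⊗[R] ↥M)))) ∧
  Function.Bijective ((TensorProduct.mk R ↥C ↥M).flip)

/-- `HasResDimLE R P n M` : `M` admits a resolution of length at most `n`
by modules satisfying `P`. -/
def HasResDimLE (P : ModuleCat.{u} R → Prop) : ℕ → ModuleCat.{u} R → Prop
  | 0, M => Subsingleton M ∨ P M
  | n + 1, M => Subsingleton M ∨ ∃ (X : ModuleCat.{u} R) (f : X →ₗ[R] M),
      P X ∧ Function.Surjective f ∧
        HasResDimLE P n (ModuleCat.of R ↥(LinearMap.ker f))

/-- The projective dimension of `M`. -/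
def projDim (M : ModuleCat.{u} R) : ℕ∞ :=
  sInf {d : ℕ∞ | ∃ n : ℕ, d = n ∧ HasResDimLE R (fun N => Module.Projective R N) n M}

/-- The first projection of the trivial extension `R ⋉ C`, as a ring homomorphism. -/
def trivExtFst (C : Type u) [AddCommGroup C] [Module R C] [Module Rᵐᵒᵖ C]
    [IsCentralScalar R C] : TrivSqZeroExt R C →+* R where
  toFun := TrivSqZeroExt.fst
  map_one' := TrivSqZeroExt.fst_one (R := R) (M := C)
  map_mul' := TrivSqZeroExt.fst_mul
  map_zero' := TrivSqZeroExt.fst_zero (R := R) (M := C)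
  map_add' := TrivSqZeroExt.fst_add

/-- The ideal `a ⊕ C` of the trivial extension `R ⋉ C`. -/
def trivExtIdeal (a : Ideal R) (C : Type u) [AddCommGroup C] [Module R C] [Module Rᵐᵒᵖ C]
    [IsCentralScalar R C] : Ideal (TrivSqZeroExt R C) :=
  Ideal.comap (trivExtFst R C) a

/-- An `R`-module `M`, viewed as a module over the trivial extension `R ⋉ C` via the
natural surjection `R ⋉ C → R`. -/
def trivExtModuleCat (C : Type u) [AddCommGroup C] [Module R C] [Module Rᵐᵒᵖ C]
    [IsCentralScalar R C] (M : Type u) [AddCommGroup M] [Module R M] :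
    ModuleCat.{u} (TrivSqZeroExt R C) :=
  letI := Module.compHom M (trivExtFst R C)
  ModuleCat.of (TrivSqZeroExt R C) M

end

noncomputable section

namespace LocalCoh

open CategoryTheory Limits Opposite

universe u

variable {R : Type u} [CommRing R]

/-- The contravariant functor `Hom(-, X)`, as a covariant functor to the opposite category. -/
abbrev homTo (X : ModuleCat.{u} R) : ModuleCat.{u} R ⥤ (ModuleCat.{u} R)ᵒᵖ :=
  ((linearYoneda R (ModuleCat.{u} R)).obj X).rightOp

/-- The complex `Hom(P, X)` in the opposite category. -/
abbrev homCx (P : ChainComplex (ModuleCat.{u} R) ℕ) (X : ModuleCat.{u} R) :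
    ChainComplex (ModuleCat.{u} R)ᵒᵖ ℕ :=
  ((homTo X).mapHomologicalComplex _).obj P

abbrev ExtMod (i : ℕ) (Y X : ModuleCat.{u} R) : ModuleCat.{u} R :=
  ((Ext R (ModuleCat.{u} R) i).obj (op Y)).obj X

def extIso {Y : ModuleCat.{u} R} (P : ProjectiveResolution Y) (X : ModuleCat.{u} R) (i : ℕ) :
    ((homTo X).leftDerived i).obj Y ≅ (homCx P.complex X).homology i :=
  P.isoLeftDerivedObj (homTo X) i

lemma extIso_naturality {Y Y' : ModuleCat.{u} R} (P : ProjectiveResolution Y)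
    (Q : ProjectiveResolution Y') (X : ModuleCat.{u} R) (i : ℕ) (f : Y' ⟶ Y)
    (φ : Q.complex ⟶ P.complex) (comm : φ.f 0 ≫ P.π.f 0 = Q.π.f 0 ≫ f) :
    ((homTo X).leftDerived i).map f ≫ (extIso P X i).hom = (extIso Q X i).hom ≫
      HomologicalComplex.homologyMap
        (((homTo X).mapHomologicalComplex (ComplexShape.down ℕ)).map φ) i :=
  ProjectiveResolution.isoLeftDerivedObj_hom_naturality f Q P φ comm (homTo X) i

lemma extIso_naturality' {Y : ModuleCat.{u} R} (P : ProjectiveResolution Y)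
    {X X' : ModuleCat.{u} R} (i : ℕ) (α : homTo X' ⟶ homTo X) :
    (NatTrans.leftDerived α i).app Y ≫ (extIso P X i).hom = (extIso P X' i).hom ≫
      HomologicalComplex.homologyMap
        ((NatTrans.mapHomologicalComplex α (ComplexShape.down ℕ)).app P.complex) i := by
  rw [P.leftDerived_app_eq α i, Category.assoc, Category.assoc]
  exact congrArg _ ((congrArg _ (Iso.inv_hom_id _)).trans (Category.comp_id _))

def extπ {Y : ModuleCat.{u} R} (P : ProjectiveResolution Y) (X : ModuleCat.{u} R) (i : ℕ) :
    ((homCx P.complex X).opcycles i).unop ⟶ ExtMod i Y X :=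
  ((extIso P X i).hom ≫ (homCx P.complex X).homologyι i).unop

/-- The cocycle `h` represents the class `e`. -/
def ExtRep {Y : ModuleCat.{u} R} (P : ProjectiveResolution Y) (X : ModuleCat.{u} R) (i : ℕ)
    (h : P.complex.X i ⟶ X) (e : ExtMod i Y X) : Prop :=
  ∃ w : ((homCx P.complex X).opcycles i).unop,
    ((homCx P.complex X).pOpcycles i).unop w = h ∧ extπ P X i w = e

section
variable {Y : ModuleCat.{u} R} {P : ProjectiveResolution Y} {X : ModuleCat.{u} R} {i : ℕ}

lemma ExtRep.add {h h' : P.complex.X i ⟶ X} {e e' : ExtMod i Y X}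
    (H : ExtRep P X i h e) (H' : ExtRep P X i h' e') : ExtRep P X i (h + h') (e + e') := by
  obtain ⟨w, hw, rfl⟩ := H
  obtain ⟨w', hw', rfl⟩ := H'
  exact ⟨w + w', by rw [map_add, hw, hw']; rfl, by rw [map_add]⟩

lemma ExtRep.smul {h : P.complex.X i ⟶ X} {e : ExtMod i Y X} (r : R)
    (H : ExtRep P X i h e) : ExtRep P X i (r • h) (r • e) := by
  obtain ⟨w, hw, rfl⟩ := H
  exact ⟨r • w, by rw [map_smul, hw]; rfl, by rw [map_smul]⟩

lemma ExtRep.exists_cocycle (e : ExtMod i Y X) : ∃ h, ExtRep P X i h e := by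
  have : Epi (extπ P X i) := 
    unop_epi_of_mono ((extIso P X i).hom ≫ (homCx P.complex X).homologyι i)
  obtain ⟨w, hw⟩ := (ModuleCat.epi_iff_surjective _).1 this e
  exact ⟨_, w, rfl, hw⟩

lemma ExtRep.d_comp {h : P.complex.X i ⟶ X} {e : ExtMod i Y X} (H : ExtRep P X i h e) :
    P.complex.d (i + 1) i ≫ h = 0 := by
  obtain ⟨w, rfl, rfl⟩ := H
  have := congrArg Quiver.Hom.unop ((homCx P.complex X).d_pOpcycles (i + 1) i)
  exact congrArg (fun f => f w) this

lemma ExtRep.of_cocycle {h : P.complex.X i ⟶ X} (hh : P.complex.d (i + 1) i ≫ h = 0) :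
    ∃ e, ExtRep P X i h e := by
  have ex : (ShortComplex.mk ((homCx P.complex X).d (i + 1) i) ((homCx P.complex X).pOpcycles i)
      ((homCx P.complex X).d_pOpcycles _ _)).Exact :=
    ShortComplex.exact_of_g_is_cokernel _
      ((homCx P.complex X).opcyclesIsCokernel (i + 1) i (by simp))
  have ex' := (ShortComplex.moduleCat_exact_iff _).1 ex.unop
  obtain ⟨w, hw⟩ := ex' h hh
  exact ⟨_, w, hw, rfl⟩

/-- `h` is a coboundary. -/
def IsBdry (P : ChainComplex (ModuleCat.{u} R) ℕ) {X : ModuleCat.{u} R} (i : ℕ)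
    (h : P.X i ⟶ X) : Prop :=
  ∃ b : P.X ((ComplexShape.down ℕ).next i) ⟶ X, P.d i _ ≫ b = h

lemma extRep_zero_iff {h : P.complex.X i ⟶ X} :
    ExtRep P X i h 0 ↔ IsBdry P.complex i h := by
  have ex : (ShortComplex.mk ((homCx P.complex X).homologyι i)
      ((homCx P.complex X).fromOpcycles i ((ComplexShape.down ℕ).next i)) (by simp)).Exact :=
    ShortComplex.exact_of_f_is_kernel _ ((homCx P.complex X).homologyIsKernel i _ rfl)
  have ex' := (ShortComplex.moduleCat_exact_iff _).1 ex.unop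
  have hd : ∀ b : P.complex.X ((ComplexShape.down ℕ).next i) ⟶ X,
      ((homCx P.complex X).pOpcycles i).unop
        (((homCx P.complex X).fromOpcycles i ((ComplexShape.down ℕ).next i)).unop b) =
        P.complex.d i _ ≫ b := by
    intro b
    have := congrArg Quiver.Hom.unop
      ((homCx P.complex X).p_fromOpcycles i ((ComplexShape.down ℕ).next i))
    exact congrArg (fun f => f b) this
  constructor
  · rintro ⟨w, rfl, hw⟩
    have : ((homCx P.complex X).homologyι i).unop w = 0 := by
      have h2 : ((extIso P X i).hom ≫ (homCx P.complex X).homologyι i).unop ≫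
          (extIso P X i).inv.unop = ((homCx P.complex X).homologyι i).unop := by
        rw [← unop_comp, ← Category.assoc, Iso.inv_hom_id, Category.id_comp]
      rw [← h2]
      exact (congrArg (extIso P X i).inv.unop hw).trans (map_zero (extIso P X i).inv.unop.hom)
    obtain ⟨b, hb⟩ := ex' w this
    exact ⟨b, by rw [← hb]; exact (hd b).symm⟩
  · rintro ⟨b, rfl⟩
    refine ⟨((homCx P.complex X).fromOpcycles i ((ComplexShape.down ℕ).next i)).unop b, hd b, ?_⟩
    have h0 : ((homCx P.complex X).homologyι i).unop
      (((homCx P.complex X).fromOpcycles i ((ComplexShape.down ℕ).next i)).unop b) = 0 := by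
      have := congrArg Quiver.Hom.unop
        ((homCx P.complex X).homologyι_comp_fromOpcycles i ((ComplexShape.down ℕ).next i))
      exact congrArg (fun f => f b) this
    exact (congrArg (extIso P X i).hom.unop h0).trans (map_zero (extIso P X i).hom.unop.hom)

lemma ExtRep.comp {h : P.complex.X i ⟶ X} {e : ExtMod i Y X} (H : ExtRep P X i h e)
    {X' : ModuleCat.{u} R} (v : X ⟶ X') :
    ExtRep P X' i (h ≫ v) (((Ext R (ModuleCat.{u} R) i).obj (op Y)).map v e) := by
  obtain ⟨w, rfl, rfl⟩ := H
  let α : homTo X' ⟶ homTo X := NatTrans.rightOp ((linearYoneda R (ModuleCat.{u} R)).map v)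
  let A := (NatTrans.mapHomologicalComplex α (ComplexShape.down ℕ)).app P.complex
  refine ⟨(HomologicalComplex.opcyclesMap A i).unop w, ?_, ?_⟩
  · have := congrArg Quiver.Hom.unop (HomologicalComplex.p_opcyclesMap A i)
    exact congrArg (fun f => f w) this
  · have h1 : (NatTrans.leftDerived α i).app Y ≫ (extIso P X i).hom ≫
        (homCx P.complex X).homologyι i = (extIso P X' i).hom ≫
        (homCx P.complex X').homologyι i ≫ HomologicalComplex.opcyclesMap A i := by
      rw [← Category.assoc, extIso_naturality' P i α, Category.assoc,
        HomologicalComplex.homologyι_naturality A i]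
    have := congrArg Quiver.Hom.unop h1
    exact (congrArg (fun f => f w) this).symm

lemma ExtRep.lift {h : P.complex.X i ⟶ X} {e : ExtMod i Y X} (H : ExtRep P X i h e)
    {Y' : ModuleCat.{u} R} (Q : ProjectiveResolution Y') (f : Y' ⟶ Y)
    (φ : Q.complex ⟶ P.complex) (comm : φ.f 0 ≫ P.π.f 0 = Q.π.f 0 ≫ f) :
    ExtRep Q X i (φ.f i ≫ h) (((Ext R (ModuleCat.{u} R) i).map f.op).app X e) := by
  obtain ⟨w, rfl, rfl⟩ := H
  let A := ((homTo X).mapHomologicalComplex (ComplexShape.down ℕ)).map φ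
  refine ⟨(HomologicalComplex.opcyclesMap A i).unop w, ?_, ?_⟩
  · have := congrArg Quiver.Hom.unop (HomologicalComplex.p_opcyclesMap A i)
    exact congrArg (fun f => f w) this
  · have h1 : ((homTo X).leftDerived i).map f ≫ (extIso P X i).hom ≫
        (homCx P.complex X).homologyι i = (extIso Q X i).hom ≫
        (homCx Q.complex X).homologyι i ≫ HomologicalComplex.opcyclesMap A i := by
      rw [← Category.assoc, extIso_naturality P Q X i f φ comm, Category.assoc,
        HomologicalComplex.homologyι_naturality A i]
    have := congrArg Quiver.Hom.unop h1
    exact (congrArg (fun f => f w) this).symm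
end

lemma isBdry_zero_iff {P : ChainComplex (ModuleCat.{u} R) ℕ} {X : ModuleCat.{u} R}
    {h : P.X 0 ⟶ X} : IsBdry P 0 h ↔ h = 0 := by
  constructor
  · rintro ⟨b, rfl⟩
    rw [P.shape _ _ (by simp), zero_comp]
  · rintro rfl
    exact ⟨0, comp_zero⟩

lemma isBdry_succ_iff {P : ChainComplex (ModuleCat.{u} R) ℕ} {X : ModuleCat.{u} R} {i : ℕ}
    {h : P.X (i + 1) ⟶ X} : IsBdry P (i + 1) h ↔ ∃ b : P.X i ⟶ X, P.d (i + 1) i ≫ b = h := by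
  have : (ComplexShape.down ℕ).next (i + 1) = i := by simp
  unfold IsBdry
  rw [this]

variable (a : Ideal R)

/-- The quotient `R / a ^ t`. -/
abbrev quotPow (t : ℕ) : ModuleCat.{u} R := ModuleCat.of R (R ⧸ a ^ t)

/-- The chosen projective resolution of `R / a ^ t`. -/
def resPow (t : ℕ) : ProjectiveResolution (quotPow a t) := projectiveResolution _

/-- The transition map `R / a ^ s → R / a ^ t`. -/
def quotPowMap {t s : ℕ} (h : t ≤ s) : quotPow a s ⟶ quotPow a t :=
  ModuleCat.ofHom <| Submodule.mapQ _ _ LinearMap.id (Ideal.pow_le_pow_right h)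

/-- A chain map lifting the transition map. -/
def resPowMap {t s : ℕ} (h : t ≤ s) : (resPow a s).complex ⟶ (resPow a t).complex :=
  ProjectiveResolution.lift (quotPowMap a h) _ _

lemma resPowMap_comm {t s : ℕ} (h : t ≤ s) :
    (resPowMap a h).f 0 ≫ (resPow a t).π.f 0 = (resPow a s).π.f 0 ≫ quotPowMap a h :=
  ProjectiveResolution.lift_commutes_zero _ _ _

abbrev LC (i : ℕ) (X : ModuleCat.{u} R) : ModuleCat.{u} R := (localCohomology a i).obj X

abbrev LCmap (i : ℕ) {X Y : ModuleCat.{u} R} (v : X ⟶ Y) : LC a i X ⟶ LC a i Y :=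
  (localCohomology a i).map v

def lcι (i : ℕ) (X : ModuleCat.{u} R) (t : ℕ) : ExtMod i (quotPow a t) X ⟶ LC a i X :=
  (colimit.ι (localCohomology.diagram (localCohomology.idealPowersDiagram a) i) (op (op t))).app X

lemma lcι_naturality (i : ℕ) {X Y : ModuleCat.{u} R} (v : X ⟶ Y) (t : ℕ)
    (e : ExtMod i (quotPow a t) X) :
    LCmap a i v (lcι a i X t e) =
      lcι a i Y t (((Ext R (ModuleCat.{u} R) i).obj (op (quotPow a t))).map v e) := by
  have := (colimit.ι (localCohomology.diagram (localCohomology.idealPowersDiagram a) i)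
    (op (op t))).naturality v
  exact (congrArg (fun f => f e) this).symm

lemma lcι_trans (i : ℕ) (X : ModuleCat.{u} R) {t s : ℕ} (h : t ≤ s)
    (e : ExtMod i (quotPow a t) X) :
    lcι a i X s (((Ext R (ModuleCat.{u} R) i).map (quotPowMap a h).op).app X e) =
      lcι a i X t e := by
  have := congrArg (fun f => f.app X)
    (colimit.w (localCohomology.diagram (localCohomology.idealPowersDiagram a) i)
    (show op (op t) ⟶ op (op s) from (homOfLE h).op.op))
  exact (congrArg (fun f => f e) this)

instance preservesFilteredColimits_forget_moduleCat :
    PreservesFilteredColimitsOfSize.{0, 0} (forget (ModuleCat.{u} R)) :=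
  preservesFilteredColimitsOfSize_of_univLE.{u, u, 0, 0} _

def lcIsColimit (i : ℕ) (X : ModuleCat.{u} R) :=
  isColimitOfPreserves ((evaluation (ModuleCat.{u} R) (ModuleCat.{u} R)).obj X)
    (colimit.isColimit (localCohomology.diagram (localCohomology.idealPowersDiagram a) i))

lemma lcι_exists (i : ℕ) (X : ModuleCat.{u} R) (x : LC a i X) : ∃ t e, lcι a i X t e = x := by
  obtain ⟨j, y, h⟩ := Concrete.isColimit_exists_rep _ (lcIsColimit a i X) x
  exact ⟨j.unop.unop, y, h⟩

lemma lcι_eq_zero (i : ℕ) (X : ModuleCat.{u} R) (t : ℕ) (e : ExtMod i (quotPow a t) X)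
    (he : lcι a i X t e = 0) : ∃ (s : ℕ) (h : t ≤ s),
      ((Ext R (ModuleCat.{u} R) i).map (quotPowMap a h).op).app X e = 0 := by
  have h0 : lcι a i X t e = lcι a i X t 0 := by rw [he, map_zero]
  obtain ⟨k, f, g, h⟩ := Concrete.isColimit_exists_of_rep_eq _ (lcIsColimit a i X)
    (i := op (op t)) (j := op (op t)) e (0 : ExtMod i (quotPow a t) X) h0
  refine ⟨k.unop.unop, leOfHom f.unop.unop, ?_⟩
  refine Eq.trans ?_ (h.trans (map_zero _))
  rfl

/-- The cocycle `h` at level `t` represents the local cohomology class `x`. -/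
def LCRep (i : ℕ) (X : ModuleCat.{u} R) (t : ℕ) (h : (resPow a t).complex.X i ⟶ X)
    (x : LC a i X) : Prop :=
  ∃ e, ExtRep (resPow a t) X i h e ∧ lcι a i X t e = x

section
variable {a} {i : ℕ} {X : ModuleCat.{u} R} {t : ℕ}

lemma LCRep.exists_rep (x : LC a i X) : ∃ t h, LCRep a i X t h x := by
  obtain ⟨t, e, rfl⟩ := lcι_exists a i X x
  obtain ⟨h, hh⟩ := ExtRep.exists_cocycle (P := resPow a t) e
  exact ⟨t, h, e, hh, rfl⟩

lemma LCRep.of_cocycle {h : (resPow a t).complex.X i ⟶ X}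
    (hh : (resPow a t).complex.d (i + 1) i ≫ h = 0) : ∃ x, LCRep a i X t h x := by
  obtain ⟨e, he⟩ := ExtRep.of_cocycle hh
  exact ⟨_, e, he, rfl⟩

lemma LCRep.d_comp {h : (resPow a t).complex.X i ⟶ X} {x : LC a i X} (H : LCRep a i X t h x) :
    (resPow a t).complex.d (i + 1) i ≫ h = 0 := by
  obtain ⟨e, he, rfl⟩ := H
  exact he.d_comp

lemma LCRep.add {h h' : (resPow a t).complex.X i ⟶ X} {x x' : LC a i X}
    (H : LCRep a i X t h x) (H' : LCRep a i X t h' x') : LCRep a i X t (h + h') (x + x') := by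
  obtain ⟨e, he, rfl⟩ := H
  obtain ⟨e', he', rfl⟩ := H'
  exact ⟨_, he.add he', map_add _ _ _⟩

lemma LCRep.smul {h : (resPow a t).complex.X i ⟶ X} {x : LC a i X} (r : R)
    (H : LCRep a i X t h x) : LCRep a i X t (r • h) (r • x) := by
  obtain ⟨e, he, rfl⟩ := H
  exact ⟨_, he.smul r, map_smul _ _ _⟩

lemma LCRep.neg {h : (resPow a t).complex.X i ⟶ X} {x : LC a i X}
    (H : LCRep a i X t h x) : LCRep a i X t (-h) (-x) := by
  simpa using H.smul (-1)

lemma LCRep.sub {h h' : (resPow a t).complex.X i ⟶ X} {x x' : LC a i X}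
    (H : LCRep a i X t h x) (H' : LCRep a i X t h' x') : LCRep a i X t (h - h') (x - x') := by
  rw [sub_eq_add_neg, sub_eq_add_neg]
  exact H.add H'.neg

lemma LCRep.trans {h : (resPow a t).complex.X i ⟶ X} {x : LC a i X} (H : LCRep a i X t h x)
    {s : ℕ} (hs : t ≤ s) : LCRep a i X s ((resPowMap a hs).f i ≫ h) x := by
  obtain ⟨e, he, rfl⟩ := H
  exact ⟨_, he.lift _ (quotPowMap a hs) _ (resPowMap_comm a hs), lcι_trans a i X hs e⟩

lemma LCRep.of_isBdry {h : (resPow a t).complex.X i ⟶ X} (H : IsBdry (resPow a t).complex i h) :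
    LCRep a i X t h 0 :=
  ⟨0, extRep_zero_iff.2 H, map_zero _⟩

lemma LCRep.exists_isBdry {h : (resPow a t).complex.X i ⟶ X} (H : LCRep a i X t h 0) :
    ∃ (s : ℕ) (hs : t ≤ s), IsBdry (resPow a s).complex i ((resPowMap a hs).f i ≫ h) := by
  obtain ⟨e, he, h0⟩ := H
  obtain ⟨s, hs, h1⟩ := lcι_eq_zero a i X t e h0
  refine ⟨s, hs, extRep_zero_iff.1 ?_⟩
  rw [← h1]
  exact he.lift _ (quotPowMap a hs) _ (resPowMap_comm a hs)

lemma LCRep.comp {h : (resPow a t).complex.X i ⟶ X} {x : LC a i X} (H : LCRep a i X t h x)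
    {Y : ModuleCat.{u} R} (v : X ⟶ Y) : LCRep a i Y t (h ≫ v) (LCmap a i v x) := by
  obtain ⟨e, he, rfl⟩ := H
  exact ⟨_, he.comp v, (lcι_naturality a i v t e).symm⟩

lemma LCRep.eq_zero {h : (resPow a t).complex.X i ⟶ X} {x : LC a i X} (H : LCRep a i X t h x)
    (Hb : IsBdry (resPow a t).complex i h) : x = 0 := by
  obtain ⟨e, he, rfl⟩ := H
  obtain ⟨w, hw, rfl⟩ := he
  obtain ⟨w', hw', h0⟩ := extRep_zero_iff.2 Hb
  have : w = w' := by
    have hm : Mono ((homCx (resPow a t).complex X).pOpcycles i).unop :=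
      unop_mono_of_epi _
    exact (ModuleCat.mono_iff_injective _).1 hm (hw.trans hw'.symm)
  rw [this, h0, map_zero]

lemma LCRep.eq {h : (resPow a t).complex.X i ⟶ X} {x y : LC a i X} (H : LCRep a i X t h x)
    (H' : LCRep a i X t h y) : x = y := by
  have h0 := H.sub H'
  rw [sub_self] at h0
  exact sub_eq_zero.1 (h0.eq_zero ⟨0, comp_zero⟩)

end

/-- A functional relation compatible with the module structures, as a linear map. -/
lemma exists_linearMap_of_rel {M N : Type*} [AddCommGroup M] [Module R M] [AddCommGroup N]
    [Module R N] (r : M → N → Prop) (total : ∀ m, ∃ n, r m n)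
    (add : ∀ m m' n n', r m n → r m' n' → r (m + m') (n + n'))
    (smul : ∀ (c : R) m n, r m n → r (c • m) (c • n))
    (uniq : ∀ n, r 0 n → n = 0) : ∃ f : M →ₗ[R] N, ∀ m n, r m n ↔ f m = n := by
  have uniq' : ∀ m n n', r m n → r m n' → n = n' := by
    intro m n n' h h'
    have h1 := add _ _ _ _ h (smul (-1) _ _ h')
    simp only [neg_smul, one_smul, add_neg_cancel] at h1
    exact add_neg_eq_zero.1 (uniq _ h1)
  choose f hf using total
  exact ⟨⟨⟨f, fun m m' => uniq' _ _ _ (hf _) (add _ _ _ _ (hf _) (hf _))⟩,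
    fun c m => uniq' _ _ _ (hf _) (smul c _ _ (hf _))⟩,
    fun m n => ⟨fun h => uniq' _ _ _ (hf m) h, fun h => h ▸ hf m⟩⟩

section Additive
variable {i : ℕ} {X Y : ModuleCat.{u} R}

lemma LCmap_add (v w : X ⟶ Y) (x : LC a i X) :
    LCmap a i (v + w) x = LCmap a i v x + LCmap a i w x := by
  obtain ⟨t, h, H⟩ := LCRep.exists_rep x
  have := H.comp (v + w)
  rw [Preadditive.comp_add] at this
  exact this.eq ((H.comp v).add (H.comp w))

lemma LCmap_smul (r : R) (v : X ⟶ Y) (x : LC a i X) :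
    LCmap a i (r • v) x = r • LCmap a i v x := by
  obtain ⟨t, h, H⟩ := LCRep.exists_rep x
  have := H.comp (r • v)
  rw [Linear.comp_smul] at this
  exact this.eq ((H.comp v).smul r)

lemma LCmap_zero (x : LC a i X) : LCmap a i (0 : X ⟶ Y) x = 0 := by
  simpa using LCmap_smul a (0 : R) (0 : X ⟶ Y) x

lemma LCmap_id (x : LC a i X) : LCmap a i (𝟙 X) x = x := by
  rw [LCmap, CategoryTheory.Functor.map_id]; rfl

lemma LCmap_comp {Z : ModuleCat.{u} R} (v : X ⟶ Y) (w : Y ⟶ Z) (x : LC a i X) :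
    LCmap a i (v ≫ w) x = LCmap a i w (LCmap a i v x) := by
  rw [LCmap, CategoryTheory.Functor.map_comp]; rfl

/-- The map induced on local cohomology by an isomorphism. -/
def LCequiv (i : ℕ) {X Y : ModuleCat.{u} R} (e : X ≃ₗ[R] Y) : LC a i X ≃ₗ[R] LC a i Y :=
  ((localCohomology a i).mapIso e.toModuleIso).toLinearEquiv
end Additive

section Sequence
variable {S : ShortComplex (ModuleCat.{u} R)} (hS : S.ShortExact) {i : ℕ}
include hS

lemma exists_lift_g {P : ModuleCat.{u} R} [Projective P] (b : P ⟶ S.X₃) :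
    ∃ b' : P ⟶ S.X₂, b' ≫ S.g = b := by
  have := hS.epi_g
  exact ⟨Projective.factorThru b S.g, Projective.factorThru_comp b S.g⟩

lemma exists_lift_f {P : ModuleCat.{u} R} (b : P ⟶ S.X₂) (hb : b ≫ S.g = 0) :
    ∃ b' : P ⟶ S.X₁, b' ≫ S.f = b := by
  have := hS.mono_f
  exact ⟨hS.exact.lift b hb, hS.exact.lift_f b hb⟩

lemma LC_exact_mid (y : LC a i S.X₂) (hy : LCmap a i S.g y = 0) :
    ∃ x, LCmap a i S.f x = y := by
  have := hS.mono_f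
  obtain ⟨t, h, H⟩ := LCRep.exists_rep y
  have H0 := H.comp S.g
  rw [hy] at H0
  obtain ⟨s, hs, b, hb⟩ := H0.exists_isBdry
  obtain ⟨b', rfl⟩ := exists_lift_g hS b
  have Hs := H.trans hs
  obtain ⟨k, hk⟩ := exists_lift_f hS ((resPowMap a hs).f i ≫ h - (resPow a s).complex.d i _ ≫ b')
    (by rw [Preadditive.sub_comp, Category.assoc, Category.assoc, hb, sub_self])
  have hkc : (resPow a s).complex.d (i + 1) i ≫ k = 0 := by
    rw [← cancel_mono S.f, Category.assoc, hk, Preadditive.comp_sub, Hs.d_comp,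
      HomologicalComplex.d_comp_d_assoc]
    simp
  obtain ⟨x, hx⟩ := LCRep.of_cocycle hkc
  refine ⟨x, ?_⟩
  have h1 := hx.comp S.f
  rw [hk] at h1
  have h2 := Hs.sub (LCRep.of_isBdry (a := a) ⟨b', rfl⟩)
  rw [sub_zero] at h2
  exact h1.eq h2

omit hS in
/-- The relation defining the connecting map. -/
def DeltaRel (S : ShortComplex (ModuleCat.{u} R)) (i : ℕ) (z : LC a i S.X₃)
    (w : LC a (i + 1) S.X₁) : Prop :=
  ∃ (t : ℕ) (h : (resPow a t).complex.X i ⟶ S.X₂) (k : (resPow a t).complex.X (i + 1) ⟶ S.X₁),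
    LCRep a i S.X₃ t (h ≫ S.g) z ∧ (resPow a t).complex.d (i + 1) i ≫ h = k ≫ S.f ∧
      LCRep a (i + 1) S.X₁ t k w

omit hS in
lemma DeltaRel.level {t : ℕ} {h : (resPow a t).complex.X i ⟶ S.X₂}
    {k : (resPow a t).complex.X (i + 1) ⟶ S.X₁} {z : LC a i S.X₃} {w : LC a (i + 1) S.X₁}
    (H : LCRep a i S.X₃ t (h ≫ S.g) z) (e : (resPow a t).complex.d (i + 1) i ≫ h = k ≫ S.f)
    (K : LCRep a (i + 1) S.X₁ t k w) {s : ℕ} (hs : t ≤ s) :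
    LCRep a i S.X₃ s (((resPowMap a hs).f i ≫ h) ≫ S.g) z ∧
    (resPow a s).complex.d (i + 1) i ≫ ((resPowMap a hs).f i ≫ h) =
      ((resPowMap a hs).f (i + 1) ≫ k) ≫ S.f ∧
    LCRep a (i + 1) S.X₁ s ((resPowMap a hs).f (i + 1) ≫ k) w := by
  refine ⟨?_, ?_, K.trans hs⟩
  · rw [Category.assoc]; exact H.trans hs
  · rw [Category.assoc, ← e, HomologicalComplex.Hom.comm_assoc]

lemma exists_delta : ∃ δ : LC a i S.X₃ →ₗ[R] LC a (i + 1) S.X₁,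
    ∀ z w, DeltaRel a S i z w ↔ δ z = w := by
  have := hS.mono_f
  refine exists_linearMap_of_rel (DeltaRel a S i) ?_ ?_ ?_ ?_
  · intro z
    obtain ⟨t, l, L⟩ := LCRep.exists_rep z
    obtain ⟨h, rfl⟩ := exists_lift_g hS l
    obtain ⟨k, hk⟩ := exists_lift_f hS ((resPow a t).complex.d (i + 1) i ≫ h)
      (by rw [Category.assoc]; exact L.d_comp)
    have hkc : (resPow a t).complex.d (i + 1 + 1) (i + 1) ≫ k = 0 := by
      rw [← cancel_mono S.f, Category.assoc, hk, HomologicalComplex.d_comp_d_assoc]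
      simp
    obtain ⟨w, hw⟩ := LCRep.of_cocycle hkc
    exact ⟨w, t, h, k, L, hk.symm, hw⟩
  · rintro z z' w w' ⟨t, h, k, H, e, K⟩ ⟨t', h', k', H', e', K'⟩
    obtain ⟨h1, h2, h3⟩ := DeltaRel.level a H e K (le_max_left t t')
    obtain ⟨h1', h2', h3'⟩ := DeltaRel.level a H' e' K' (le_max_right t t')
    refine ⟨max t t', (resPowMap a (le_max_left t t')).f i ≫ h +
      (resPowMap a (le_max_right t t')).f i ≫ h', _, ?_, ?_, h3.add h3'⟩
    · rw [Preadditive.add_comp]; exact h1.add h1'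
    · rw [Preadditive.add_comp, Preadditive.comp_add, h2, h2']
  · rintro c z w ⟨t, h, k, H, e, K⟩
    refine ⟨t, c • h, c • k, ?_, ?_, K.smul c⟩
    · rw [Linear.smul_comp]; exact H.smul c
    · rw [Linear.smul_comp, Linear.comp_smul, e]
  · rintro w ⟨t, h, k, H, e, K⟩
    obtain ⟨s, hs, b, hb⟩ := H.exists_isBdry
    obtain ⟨-, h2, h3⟩ := DeltaRel.level a H e K hs
    obtain ⟨b', rfl⟩ := exists_lift_g hS b
    obtain ⟨m, hm⟩ := exists_lift_f hS
      ((resPowMap a hs).f i ≫ h - (resPow a s).complex.d i _ ≫ b')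
      (by rw [Preadditive.sub_comp, Category.assoc, Category.assoc, hb, sub_self])
    refine h3.eq_zero (isBdry_succ_iff.2 ⟨m, ?_⟩)
    rw [← cancel_mono S.f, Category.assoc, hm, Preadditive.comp_sub, h2,
      HomologicalComplex.d_comp_d_assoc]
    simp

/-- The connecting homomorphism. -/
def delta (i : ℕ) : LC a i S.X₃ →ₗ[R] LC a (i + 1) S.X₁ := (exists_delta a hS).choose

lemma deltaRel_iff {z : LC a i S.X₃} {w : LC a (i + 1) S.X₁} :
    DeltaRel a S i z w ↔ delta a hS i z = w := (exists_delta a hS).choose_spec z w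

lemma delta_exact_right (z : LC a i S.X₃) (hz : delta a hS i z = 0) :
    ∃ y, LCmap a i S.g y = z := by
  obtain ⟨t, h, k, H, e, K⟩ := (deltaRel_iff a hS).2 hz
  obtain ⟨s, hs, hb⟩ := K.exists_isBdry
  obtain ⟨m, hm⟩ := isBdry_succ_iff.1 hb
  obtain ⟨h1, h2, -⟩ := DeltaRel.level a H e K hs
  have hc : (resPow a s).complex.d (i + 1) i ≫ ((resPowMap a hs).f i ≫ h - m ≫ S.f) = 0 := by
    rw [Preadditive.comp_sub, h2, ← hm, Category.assoc, sub_self]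
  obtain ⟨y, hy⟩ := LCRep.of_cocycle hc
  refine ⟨y, ?_⟩
  have h3 := hy.comp S.g
  rw [Preadditive.sub_comp, Category.assoc m, S.zero, comp_zero, sub_zero] at h3
  exact h3.eq h1

lemma delta_comp_map (y : LC a i S.X₂) : delta a hS i (LCmap a i S.g y) = 0 := by
  obtain ⟨t, h, H⟩ := LCRep.exists_rep y
  refine (deltaRel_iff a hS).1 ⟨t, h, 0, H.comp S.g, ?_, LCRep.of_isBdry ⟨0, comp_zero⟩⟩
  rw [H.d_comp, zero_comp]

lemma delta_exact_left (w : LC a (i + 1) S.X₁) (hw : LCmap a (i + 1) S.f w = 0) :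
    ∃ z, delta a hS i z = w := by
  obtain ⟨t, k, K⟩ := LCRep.exists_rep w
  have K0 := K.comp S.f
  rw [hw] at K0
  obtain ⟨s, hs, hb⟩ := K0.exists_isBdry
  obtain ⟨b, hb⟩ := isBdry_succ_iff.1 hb
  have hc : (resPow a s).complex.d (i + 1) i ≫ b ≫ S.g = 0 := by
    rw [← Category.assoc, hb, Category.assoc, Category.assoc, S.zero, comp_zero, comp_zero]
  obtain ⟨z, hz⟩ := LCRep.of_cocycle hc
  exact ⟨z, (deltaRel_iff a hS).1 ⟨s, b, _, hz, by rw [hb, Category.assoc], K.trans hs⟩⟩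

lemma map_comp_delta (z : LC a i S.X₃) : LCmap a (i + 1) S.f (delta a hS i z) = 0 := by
  obtain ⟨t, h, k, H, e, K⟩ := (deltaRel_iff a hS).2 (rfl : delta a hS i z = _)
  exact (K.comp S.f).eq_zero (isBdry_succ_iff.2 ⟨h, e⟩)

end Sequence

lemma subsingleton_LC_of_injective {E : ModuleCat.{u} R} [Injective E] (i : ℕ) :
    Subsingleton (LC a (i + 1) E) := by
  refine subsingleton_of_forall_eq 0 fun x => ?_
  obtain ⟨t, h, H⟩ := LCRep.exists_rep x
  refine H.eq_zero (isBdry_succ_iff.2 ?_)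
  exact ⟨((resPow a t).exact_succ i).descToInjective h H.d_comp,
    ((resPow a t).exact_succ i).comp_descToInjective h H.d_comp⟩

section Zero
variable {X : ModuleCat.{u} R}

lemma resPow_d_π (t : ℕ) : (resPow a t).complex.d 1 0 ≫ (resPow a t).π.f 0 = 0 :=
  (resPow a t).complex_d_comp_π_f_zero

/-- The augmentation of the chosen resolution. -/
def resPowπ (t : ℕ) : (resPow a t).complex.X 0 ⟶ quotPow a t := (resPow a t).π.f 0

instance (t : ℕ) : Epi (resPowπ a t) :=
  inferInstanceAs (Epi ((resPow a t).π.f 0))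

lemma resPowπ_comm {t s : ℕ} (h : t ≤ s) :
    (resPowMap a h).f 0 ≫ resPowπ a t = resPowπ a s ≫ quotPowMap a h := resPowMap_comm a h

lemma exists_desc_π (t : ℕ) (h : (resPow a t).complex.X 0 ⟶ X)
    (hh : (resPow a t).complex.d 1 0 ≫ h = 0) : ∃ u : quotPow a t ⟶ X, resPowπ a t ≫ u = h := by
  have : Epi (ShortComplex.mk _ _ (resPow a t).complex_d_comp_π_f_zero).g :=
    inferInstanceAs (Epi ((resPow a t).π.f 0))
  exact ⟨(resPow a t).exact₀.desc h hh, (resPow a t).exact₀.g_desc h hh⟩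

def EvRel (X : ModuleCat.{u} R) (z : LC a 0 X) (x : X) : Prop :=
  ∃ (t : ℕ) (u : quotPow a t ⟶ X), LCRep a 0 X t (resPowπ a t ≫ u) z ∧ u (1 : R ⧸ a ^ t) = x

lemma EvRel.level {t : ℕ} {u : quotPow a t ⟶ X} {z : LC a 0 X}
    (H : LCRep a 0 X t (resPowπ a t ≫ u) z) {s : ℕ} (hs : t ≤ s) :
    LCRep a 0 X s (resPowπ a s ≫ quotPowMap a hs ≫ u) z ∧
      (quotPowMap a hs ≫ u) (1 : R ⧸ a ^ s) = u (1 : R ⧸ a ^ t) := by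
  refine ⟨?_, rfl⟩
  have := H.trans hs
  rwa [← Category.assoc, resPowπ_comm, Category.assoc] at this

lemma quotPow_hom_ext {t : ℕ} {u v : quotPow a t ⟶ X} (h : u (1 : R ⧸ a ^ t) = v (1 : R ⧸ a ^ t)) :
    u = v := by
  ext : 1
  refine Submodule.linearMap_qext _ (LinearMap.ext_ring ?_)
  exact h

lemma exists_ev : ∃ f : LC a 0 X →ₗ[R] X, ∀ z x, EvRel a X z x ↔ f z = x := by
  refine exists_linearMap_of_rel (EvRel a X) ?_ ?_ ?_ ?_
  · intro z
    obtain ⟨t, h, H⟩ := LCRep.exists_rep z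
    obtain ⟨u, rfl⟩ := exists_desc_π a t h H.d_comp
    exact ⟨_, t, u, H, rfl⟩
  · rintro z z' _ _ ⟨t, u, H, rfl⟩ ⟨t', u', H', rfl⟩
    obtain ⟨h1, h2⟩ := EvRel.level a H (le_max_left t t')
    obtain ⟨h1', h2'⟩ := EvRel.level a H' (le_max_right t t')
    refine ⟨max t t', quotPowMap a (le_max_left t t') ≫ u + quotPowMap a (le_max_right t t') ≫ u',
      ?_, ?_⟩
    · rw [Preadditive.comp_add]; exact h1.add h1'
    · rw [← h2, ← h2']; rfl
  · rintro c z _ ⟨t, u, H, rfl⟩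
    refine ⟨t, c • u, ?_, rfl⟩
    rw [Linear.comp_smul]; exact H.smul c
  · rintro _ ⟨t, u, H, rfl⟩
    obtain ⟨s, hs, hb⟩ := H.exists_isBdry
    rw [isBdry_zero_iff, ← Category.assoc, resPowπ_comm, Category.assoc] at hb
    have := (cancel_epi (resPowπ a s)).1 (hb.trans comp_zero.symm)
    rw [← (EvRel.level a H hs).2, this]
    rfl

/-- The embedding of `H_a^0(X)` in `X`. -/
def ev (X : ModuleCat.{u} R) : LC a 0 X →ₗ[R] X := (exists_ev a).choose

lemma evRel_iff {z : LC a 0 X} {x : X} : EvRel a X z x ↔ ev a X z = x :=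
  (exists_ev a).choose_spec z x

lemma ev_injective : Function.Injective (ev a X) := by
  rw [injective_iff_map_eq_zero]
  intro z hz
  obtain ⟨t, u, H, hu⟩ := (evRel_iff a).2 hz
  have : u = 0 := quotPow_hom_ext a hu
  rw [this, comp_zero] at H
  exact H.eq_zero ⟨0, comp_zero⟩

lemma ev_naturality {Y : ModuleCat.{u} R} (v : X ⟶ Y) (z : LC a 0 X) :
    ev a Y (LCmap a 0 v z) = v (ev a X z) := by
  obtain ⟨t, u, H, hu⟩ := (evRel_iff a).2 (rfl : ev a X z = _)
  refine (evRel_iff a).1 ⟨t, u ≫ v, ?_, ?_⟩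
  · rw [← Category.assoc]; exact H.comp v
  · rw [← hu]; rfl

lemma mem_range_ev {x : X} : x ∈ LinearMap.range (ev a X) ↔ ∃ s : ℕ, ∀ r ∈ a ^ s, r • x = 0 := by
  constructor
  · rintro ⟨z, hz⟩
    obtain ⟨t, u, H, rfl⟩ := (evRel_iff a).2 hz
    refine ⟨t, fun r hr => ?_⟩
    have h1 : r • (1 : R ⧸ a ^ t) = 0 := by
      rw [← map_one (Ideal.Quotient.mk (a ^ t)), ← Ideal.Quotient.mk_eq_mk,
        ← Submodule.Quotient.mk_smul,
        Submodule.Quotient.mk_eq_zero]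
      simpa using hr
    exact (map_smul u.hom r (1 : R ⧸ a ^ t)).symm.trans ((congrArg u.hom h1).trans (map_zero u.hom))
  · rintro ⟨s, hs⟩
    let u : quotPow a s ⟶ X := ModuleCat.ofHom
      (Submodule.liftQ (a ^ s) (LinearMap.toSpanSingleton R X x) fun r hr => hs r hr)
    have hc : (resPow a s).complex.d 1 0 ≫ resPowπ a s ≫ u = 0 := by
      rw [← Category.assoc]
      exact (congrArg (fun f => f ≫ u) (resPow_d_π a s)).trans zero_comp
    obtain ⟨z, hz⟩ := LCRep.of_cocycle hc
    exact ⟨z, (evRel_iff a).1 ⟨s, u, hz, one_smul R x⟩⟩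

end Zero

section Linear
variable {A B C : Type u} [AddCommGroup A] [Module R A] [AddCommGroup B] [Module R B]
  [AddCommGroup C] [Module R C]

/-- Local cohomology of an unbundled module. -/
abbrev HC (i : ℕ) (A : Type u) [AddCommGroup A] [Module R A] : ModuleCat.{u} R :=
  LC a i (ModuleCat.of R A)

/-- The map on local cohomology induced by a linear map. -/
def HCmap (i : ℕ) (f : A →ₗ[R] B) : HC a i A →ₗ[R] HC a i B :=
  (LCmap a i (ModuleCat.ofHom f)).hom

lemma HCmap_comp (i : ℕ) (g : B →ₗ[R] C) (f : A →ₗ[R] B) (x : HC a i A) :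
    HCmap a i (g ∘ₗ f) x = HCmap a i g (HCmap a i f x) :=
  LCmap_comp a (ModuleCat.ofHom f) (ModuleCat.ofHom g) x

lemma HCmap_id (i : ℕ) (x : HC a i A) : HCmap a i (LinearMap.id : A →ₗ[R] A) x = x :=
  LCmap_id a x

lemma HCmap_add (i : ℕ) (f g : A →ₗ[R] B) (x : HC a i A) :
    HCmap a i (f + g) x = HCmap a i f x + HCmap a i g x :=
  LCmap_add a (ModuleCat.ofHom f) (ModuleCat.ofHom g) x

lemma HCmap_smul (i : ℕ) (r : R) (f : A →ₗ[R] B) (x : HC a i A) :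
    HCmap a i (r • f) x = r • HCmap a i f x :=
  LCmap_smul a r (ModuleCat.ofHom f) x

lemma HCmap_zero (i : ℕ) (x : HC a i A) : HCmap a i (0 : A →ₗ[R] B) x = 0 :=
  LCmap_zero a x

/-- The embedding of zeroth local cohomology. -/
def hev (A : Type u) [AddCommGroup A] [Module R A] : HC a 0 A →ₗ[R] A := ev a (ModuleCat.of R A)

lemma hev_injective : Function.Injective (hev a A) := ev_injective a

lemma hev_naturality (f : A →ₗ[R] B) (z : HC a 0 A) :
    hev a B (HCmap a 0 f z) = f (hev a A z) := ev_naturality a (ModuleCat.ofHom f) z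

/-- `x` is killed by a power of `a`. -/
def IsTor {A : Type u} [AddCommGroup A] [Module R A] (x : A) : Prop :=
  ∃ s : ℕ, ∀ r ∈ a ^ s, r • x = 0

lemma exists_hev {x : A} (hx : IsTor a x) : ∃ z, hev a A z = x :=
  (mem_range_ev a (X := ModuleCat.of R A)).2 hx

lemma isTor_hev (z : HC a 0 A) : IsTor a (hev a A z) :=
  (mem_range_ev a (X := ModuleCat.of R A)).1 ⟨z, rfl⟩

variable {a} in
lemma IsTor.map {x : A} (hx : IsTor a x) (f : A →ₗ[R] B) : IsTor a (f x) := by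
  obtain ⟨s, hs⟩ := hx
  exact ⟨s, fun r hr => by rw [← map_smul, hs r hr, map_zero]⟩

variable {a} in
lemma IsTor.of_map {x : A} {f : A →ₗ[R] B} (hf : Function.Injective f) (hx : IsTor a (f x)) :
    IsTor a x := by
  obtain ⟨s, hs⟩ := hx
  exact ⟨s, fun r hr => hf (by rw [map_smul, hs r hr, map_zero])⟩

/-- The torsion submodule. -/
def Gam (A : Type u) [AddCommGroup A] [Module R A] : Submodule R A where
  carrier := {x | IsTor a x}
  zero_mem' := ⟨0, fun r _ => smul_zero r⟩
  add_mem' := by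
    rintro x y ⟨s, hs⟩ ⟨t, ht⟩
    refine ⟨max s t, fun r hr => ?_⟩
    rw [smul_add, hs r (Ideal.pow_le_pow_right (le_max_left _ _) hr),
      ht r (Ideal.pow_le_pow_right (le_max_right _ _) hr), add_zero]
  smul_mem' := by
    rintro c x ⟨s, hs⟩
    exact ⟨s, fun r hr => by rw [smul_comm, hs r hr, smul_zero]⟩

/-- Short exact sequences of linear maps. -/
structure SES (f : A →ₗ[R] B) (g : B →ₗ[R] C) : Prop where
  inj : Function.Injective f
  exact : Function.Exact f g
  surj : Function.Surjective g

lemma SES.of_surjective {g : B →ₗ[R] C} (hg : Function.Surjective g) :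
    SES (LinearMap.ker g).subtype g :=
  ⟨Subtype.val_injective, LinearMap.exact_subtype_ker_map g, hg⟩

lemma SES.of_injective {f : A →ₗ[R] B} (hf : Function.Injective f) :
    SES f (LinearMap.range f).mkQ :=
  ⟨hf, LinearMap.exact_map_mkQ_range f, Submodule.mkQ_surjective _⟩

variable {f : A →ₗ[R] B} {g : B →ₗ[R] C}

lemma SES.short (h : SES f g) : (ShortComplex.mk (ModuleCat.ofHom f) (ModuleCat.ofHom g)
    (by ext x; exact h.exact.apply_apply_eq_zero x)).ShortExact := by
  have hf : Mono (ModuleCat.ofHom f) := (ModuleCat.mono_iff_injective _).2 h.inj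
  have hg : Epi (ModuleCat.ofHom g) := (ModuleCat.epi_iff_surjective _).2 h.surj
  exact ShortComplex.ShortExact.mk ((ShortComplex.moduleCat_exact_iff _).2
    fun x hx => (h.exact x).1 hx)

lemma SES.exact_mid (h : SES f g) (i : ℕ) : Function.Exact (HCmap a i f) (HCmap a i g) := by
  intro y
  refine ⟨fun hy => LC_exact_mid a h.short y hy, ?_⟩
  rintro ⟨x, rfl⟩
  rw [← HCmap_comp, h.exact.linearMap_comp_eq_zero, HCmap_zero]

/-- The connecting map. -/
def SES.dlt (h : SES f g) (i : ℕ) : HC a i C →ₗ[R] HC a (i + 1) A := delta a h.short i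

lemma SES.exact_right (h : SES f g) (i : ℕ) : Function.Exact (HCmap a i g) (h.dlt a i) := by
  intro y
  refine ⟨fun hy => delta_exact_right a h.short y hy, ?_⟩
  rintro ⟨x, rfl⟩
  exact delta_comp_map a h.short x

lemma SES.exact_left (h : SES f g) (i : ℕ) : Function.Exact (h.dlt a i) (HCmap a (i + 1) f) := by
  intro y
  refine ⟨fun hy => delta_exact_left a h.short y hy, ?_⟩
  rintro ⟨x, rfl⟩
  exact map_comp_delta a h.short x

lemma subsingleton_HC_of_injective (E : Type u) [AddCommGroup E] [Module R E]
    [Module.Injective R E] (i : ℕ) : Subsingleton (HC a (i + 1) E) := by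
  have := Module.injective_object_of_injective_module R E
  exact subsingleton_LC_of_injective a i

lemma exists_injective_embedding (A : Type u) [AddCommGroup A] [Module R A] :
    ∃ (E : Type u) (_ : AddCommGroup E) (_ : Module R E) (f : A →ₗ[R] E),
      Module.Injective R E ∧ Function.Injective f := by
  let E := Injective.under (ModuleCat.of R A)
  have : Injective (ModuleCat.of R E) := inferInstanceAs (Injective (Injective.under _))
  exact ⟨E, inferInstance, inferInstance, (Injective.ι (ModuleCat.of R A)).hom,
    Module.injective_module_of_injective_object R E,
    (ModuleCat.mono_iff_injective _).1 inferInstance⟩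

/-- Dimension shifting along an embedding into an acyclic module. -/
lemma SES.subsingleton_shift (h : SES f g) {i : ℕ} (hB : Subsingleton (HC a (i + 1) B))
    (hC : Subsingleton (HC a i C)) : Subsingleton (HC a (i + 1) A) := by
  refine subsingleton_of_forall_eq 0 fun w => ?_
  obtain ⟨z, rfl⟩ := (h.exact_left a i w).1 (Subsingleton.elim _ _)
  rw [Subsingleton.elim z 0, map_zero]

lemma SES.subsingleton_shift' (h : SES f g) {i : ℕ} (hB : Subsingleton (HC a i B))
    (hA : Subsingleton (HC a (i + 1) A)) : Subsingleton (HC a i C) := by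
  refine subsingleton_of_forall_eq 0 fun w => ?_
  obtain ⟨z, rfl⟩ := (h.exact_right a i w).1 (Subsingleton.elim _ _)
  rw [Subsingleton.elim z 0, map_zero]

/-- `H^1(A)` vanishes when torsion elements lift along a surjection from an acyclic module. -/
lemma SES.subsingleton_one (h : SES f g) (hB : Subsingleton (HC a 1 B))
    (hl : ∀ c : C, IsTor a c → ∃ b : B, IsTor a b ∧ g b = c) : Subsingleton (HC a 1 A) := by
  refine subsingleton_of_forall_eq 0 fun w => ?_
  obtain ⟨z, rfl⟩ := (h.exact_left a 0 w).1 (Subsingleton.elim _ _)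
  obtain ⟨b, hb, hbc⟩ := hl _ (isTor_hev a z)
  obtain ⟨y, rfl⟩ := exists_hev a hb
  have : HCmap a 0 g y = z := hev_injective a (by rw [hev_naturality, hbc])
  exact (h.exact_right a 0 z).2 ⟨y, this⟩

lemma SES.exists_lift_isTor (h : SES f g) (hA : Subsingleton (HC a 1 A)) (c : C)
    (hc : IsTor a c) : ∃ b : B, IsTor a b ∧ g b = c := by
  obtain ⟨z, rfl⟩ := exists_hev a hc
  obtain ⟨y, rfl⟩ := (h.exact_right a 0 z).1 (Subsingleton.elim _ _)
  exact ⟨hev a B y, isTor_hev a y, (hev_naturality a g y).symm⟩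

lemma exists_pow_smul_eq_zero {A : Type u} [AddCommGroup A] [Module R A] {N : Submodule R A}
    (hN : N.FG) (h : ∀ x ∈ N, IsTor a x) : ∃ s : ℕ, ∀ r ∈ a ^ s, ∀ x ∈ N, r • x = 0 := by
  obtain ⟨S, rfl⟩ := hN
  choose! f hf using fun x (hx : x ∈ S) => h x (Submodule.subset_span hx)
  refine ⟨S.sup f, fun r hr x hx => ?_⟩
  induction hx using Submodule.span_induction with
  | mem x hx => exact hf x hx r (Ideal.pow_le_pow_right (Finset.le_sup hx) hr)
  | zero => exact smul_zero r
  | add x y _ _ hx hy => rw [smul_add, hx, hy, add_zero]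
  | smul c x _ hx => rw [smul_comm, hx, smul_zero]

end Linear

section Noetherian
variable [IsNoetherianRing R]

lemma injective_Gam (E : Type u) [AddCommGroup E] [Module R E] [Module.Injective R E] :
    Module.Injective R (Gam a E) := by
  refine Module.Baer.injective fun I φ => ?_
  obtain ⟨s, hs⟩ := exists_pow_smul_eq_zero a (N := LinearMap.range ((Gam a E).subtype ∘ₗ φ))
    (by rw [LinearMap.range_eq_map]; exact (IsNoetherian.noetherian (⊤ : Submodule R I)).map _)
    (by rintro _ ⟨x, rfl⟩; exact (φ x).2)
  obtain ⟨k, hk⟩ := Ideal.exists_pow_inf_eq_pow_smul a I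
  let q : I →ₗ[R] R ⧸ a ^ (s + k) := (a ^ (s + k)).mkQ ∘ₗ I.subtype
  have hq : LinearMap.ker q ≤ LinearMap.ker ((Gam a E).subtype ∘ₗ φ) := by
    intro x hx
    have hx1 : (x : R) ∈ a ^ (s + k) := by
      exact (Submodule.Quotient.mk_eq_zero _).1 hx
    have hx2 : (x : R) ∈ a ^ (s + k) • (⊤ : Submodule R R) ⊓ I := ⟨by simpa using hx1, x.2⟩
    rw [hk (s + k) (by omega), Nat.add_sub_cancel] at hx2
    have hx3 : (x : R) ∈ a ^ s • (I : Submodule R R) :=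
      Submodule.smul_mono le_rfl inf_le_right hx2
    have hx4 : x ∈ a ^ s • (⊤ : Submodule R I) := by
      have : a ^ s • (I : Submodule R R) = (a ^ s • (⊤ : Submodule R I)).map I.subtype := by
        rw [Submodule.map_smul'', Submodule.map_top, Submodule.range_subtype]
      rw [this] at hx3
      obtain ⟨y, hy, hyx⟩ := hx3
      rwa [Subtype.ext hyx] at hy
    refine Submodule.smul_induction_on (p := fun x => x ∈ LinearMap.ker ((Gam a E).subtype ∘ₗ φ))
      hx4 (fun r hr y _ => ?_) (fun y z hy hz => add_mem hy hz)
    rw [LinearMap.mem_ker, map_smul]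
    exact hs r hr _ ⟨y, rfl⟩
  obtain ⟨ψ, hψ⟩ := Module.Injective.out (Q := E) ((LinearMap.ker q).liftQ q le_rfl)
    (by rw [← LinearMap.ker_eq_bot]; exact Submodule.ker_liftQ_eq_bot _ _ _ le_rfl)
    ((LinearMap.ker q).liftQ _ hq)
  have htor : ∀ r : R, (ψ ∘ₗ (a ^ (s + k)).mkQ) r ∈ Gam a E := fun r => by
    refine IsTor.map (f := ψ) ⟨s + k, fun c hc => ?_⟩
    rw [← map_smul, Submodule.mkQ_apply, Submodule.Quotient.mk_eq_zero, smul_eq_mul]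
    exact Ideal.mul_mem_right _ _ hc
  refine ⟨(ψ ∘ₗ (a ^ (s + k)).mkQ).codRestrict _ htor, fun x hx => Subtype.ext ?_⟩
  exact hψ (Submodule.Quotient.mk ⟨x, hx⟩)

lemma subsingleton_HC_of_isTor (i : ℕ) : ∀ (T : Type u) [AddCommGroup T] [Module R T],
    (∀ x : T, IsTor a x) → Subsingleton (HC a (i + 1) T) := by
  have key : ∀ (T : Type u) [AddCommGroup T] [Module R T], (∀ x : T, IsTor a x) →
      ∃ (E : Type u) (_ : AddCommGroup E) (_ : Module R E) (f : T →ₗ[R] E),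
        Module.Injective R E ∧ Function.Injective f ∧ ∀ x : E, IsTor a x := by
    intro T _ _ hT
    obtain ⟨E, _, _, f, hE, hf⟩ := exists_injective_embedding (R := R) T
    refine ⟨Gam a E, inferInstance, inferInstance, f.codRestrict _ fun x => (hT x).map f,
      injective_Gam a E, fun x y h => hf (congrArg Subtype.val h), fun x => ?_⟩
    exact IsTor.of_map (f := (Gam a E).subtype) Subtype.val_injective x.2
  induction i with
  | zero =>
    intro T _ _ hT
    obtain ⟨E, _, _, f, hE, hf, hEt⟩ := key T hT
    refine (SES.of_injective hf).subsingleton_one a (subsingleton_HC_of_injective a E 0)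
      fun c _ => ?_
    obtain ⟨b, rfl⟩ := Submodule.mkQ_surjective _ c
    exact ⟨b, hEt b, rfl⟩
  | succ i ih =>
    intro T _ _ hT
    obtain ⟨E, _, _, f, hE, hf, hEt⟩ := key T hT
    refine (SES.of_injective hf).subsingleton_shift a (subsingleton_HC_of_injective a E _)
      (ih _ fun c => ?_)
    obtain ⟨b, rfl⟩ := Submodule.mkQ_surjective _ c
    exact (hEt b).map _

/-- In an injective torsion module elements become divisible up to powers of `x`. -/
lemma exists_pow_smul_eq (E : Type u) [AddCommGroup E] [Module R E] [Module.Injective R E]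
    (x : R) (t : ℕ) (g : E) : ∃ (s : ℕ) (g' : E), x ^ s • g = x ^ (s + t) • g' := by
  let F : ℕ →o Ideal R := ⟨fun s => LinearMap.ker (LinearMap.mul R R (x ^ s)), fun m n hmn r hr => by
    obtain ⟨k, rfl⟩ := Nat.exists_eq_add_of_le hmn
    simp only [LinearMap.mem_ker, LinearMap.mul_apply'] at hr ⊢
    rw [pow_add, mul_right_comm, hr, zero_mul]⟩
  obtain ⟨s, hs⟩ := monotone_stabilizes_iff_noetherian.2 (inferInstanceAs (IsNoetherian R R)) F
  let L := LinearMap.mul R R (x ^ (s + t))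
  have hL : LinearMap.ker L ≤ LinearMap.ker (LinearMap.toSpanSingleton R E (x ^ s • g)) := by
    intro r hr
    have : r ∈ F s := by rw [hs (s + t) (by omega)]; exact hr
    have h1 : x ^ s * r = 0 := this
    rw [LinearMap.mem_ker, LinearMap.toSpanSingleton_apply, smul_smul, mul_comm, h1, zero_smul]
  obtain ⟨ψ, hψ⟩ := Module.Injective.out (Q := E) ((LinearMap.ker L).liftQ L le_rfl)
    (by rw [← LinearMap.ker_eq_bot]; exact Submodule.ker_liftQ_eq_bot _ _ _ le_rfl)
    ((LinearMap.ker L).liftQ _ hL)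
  refine ⟨s, ψ 1, ?_⟩
  have := hψ (Submodule.Quotient.mk 1)
  simp only [Submodule.liftQ_apply, L, LinearMap.mul_apply', mul_one,
    LinearMap.toSpanSingleton_apply, one_smul] at this
  rw [← this, ← map_smul, smul_eq_mul, mul_one]

lemma subsingleton_HC_one_sup_span {Z E Q E' W : Type u} [AddCommGroup Z] [Module R Z]
    [AddCommGroup E] [Module R E] [AddCommGroup Q] [Module R Q] [AddCommGroup E'] [Module R E']
    [AddCommGroup W] [Module R W] {f : Z →ₗ[R] E} {π : E →ₗ[R] Q} {f' : Q →ₗ[R] E'}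
    {π' : E' →ₗ[R] W} (h : SES f π) (h' : SES f' π') [Module.Injective R E]
    [Module.Injective R E'] (hZ : Subsingleton (HC a 1 Z)) (hQ : Subsingleton (HC a 1 Q)) (x : R) :
    Subsingleton (HC (a ⊔ Ideal.span {x}) 1 Q) := by
  refine h'.subsingleton_one _ (subsingleton_HC_of_injective _ E' 0) fun c ⟨t, hc⟩ => ?_
  obtain ⟨e, he, rfl⟩ := h'.exists_lift_isTor a hQ c
    ⟨t, fun r hr => hc r (Ideal.pow_right_mono le_sup_left t hr)⟩
  have hx : π' (x ^ t • e) = 0 := by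
    rw [map_smul]
    exact hc _ (Ideal.pow_mem_pow (Ideal.mem_sup_right (Ideal.mem_span_singleton_self x)) t)
  obtain ⟨q, hq⟩ := (h'.exact _).1 hx
  have hqt : IsTor a q := IsTor.of_map h'.inj (by rw [hq]; exact (Gam a E').smul_mem _ he)
  obtain ⟨g, hg, rfl⟩ := h.exists_lift_isTor a hZ q hqt
  have := injective_Gam a E
  obtain ⟨s, ⟨g₁, hg₁⟩, hs⟩ := exists_pow_smul_eq (Gam a E) x t ⟨g, hg⟩
  have hs' : x ^ s • g = x ^ (s + t) • g₁ := congrArg Subtype.val hs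
  refine ⟨e - f' (π g₁), ?_, by rw [map_sub, h'.exact.apply_apply_eq_zero, sub_zero]⟩
  obtain ⟨p, hp⟩ : IsTor a (e - f' (π g₁)) :=
    (Gam a E').sub_mem he ((IsTor.map hg₁ π).map f')
  have hxe : x ^ (s + t) • (e - f' (π g₁)) = 0 := by
    rw [smul_sub, ← map_smul f', ← map_smul π, ← hs', map_smul π, map_smul f', hq, smul_smul,
      pow_add, sub_self]
  refine ⟨p + (s + t), fun r hr => ?_⟩
  obtain ⟨u, hu, v, hv, rfl⟩ := Submodule.mem_sup.1 (Ideal.sup_pow_add_le_pow_sup_pow hr)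
  rw [Ideal.span_singleton_pow, Ideal.mem_span_singleton'] at hv
  obtain ⟨c, rfl⟩ := hv
  rw [add_smul, hp u hu, mul_smul, hxe, smul_zero, add_zero]

/-- Local cohomology of a fixed ideal vanishes in high degrees. -/
lemma exists_cohomDim : ∃ r : ℕ, ∀ i, r < i → ∀ (X : Type u) [AddCommGroup X] [Module R X],
    Subsingleton (HC a i X) := by
  classical
  obtain ⟨S, rfl⟩ := (IsNoetherian.noetherian a : a.FG)
  induction S using Finset.induction_on with
  | empty =>
    refine ⟨0, fun i hi X _ _ => ?_⟩
    obtain ⟨j, rfl⟩ := Nat.exists_eq_add_of_lt hi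
    rw [zero_add]
    refine subsingleton_HC_of_isTor _ j X fun x => ⟨1, fun r hr => ?_⟩
    have : r = 0 := by simpa using hr
    rw [this, zero_smul]
  | insert x S _ ih =>
    obtain ⟨r, hr⟩ := ih
    refine ⟨r + 1, fun i hi => ?_⟩
    have hspan : Submodule.span R (↑(insert x S) : Set R) =
        Submodule.span R (S : Set R) ⊔ Ideal.span {x} := by
      rw [Finset.coe_insert, Submodule.span_insert, sup_comm]
    rw [hspan]
    generalize hb : (Submodule.span R (S : Set R) : Ideal R) = b at hr ⊢
    -- the vanishing of `H_b` in high degrees, transported to cosyzygies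
    have key : ∀ (k : ℕ) (X : Type u) [AddCommGroup X] [Module R X],
        Subsingleton (HC b (k + 1) X) → Subsingleton (HC b (k + 2) X) →
        Subsingleton (HC (b ⊔ Ideal.span {x}) (k + 2) X) := by
      intro k
      induction k with
      | zero =>
        intro X _ _ h1 h2
        obtain ⟨E, _, _, f, hE, hf⟩ := exists_injective_embedding (R := R) X
        have hX := SES.of_injective hf
        obtain ⟨E', _, _, f', hE', hf'⟩ := exists_injective_embedding (R := R)
          (E ⧸ LinearMap.range f)
        have hQ := SES.of_injective hf'
        exact hX.subsingleton_shift _ (subsingleton_HC_of_injective _ E _)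
          (subsingleton_HC_one_sup_span b hX hQ h1
            (hX.subsingleton_shift' b (subsingleton_HC_of_injective _ E _) h2) x)
      | succ k ih =>
        intro X _ _ h1 h2
        obtain ⟨E, _, _, f, hE, hf⟩ := exists_injective_embedding (R := R) X
        have hX := SES.of_injective hf
        exact hX.subsingleton_shift _ (subsingleton_HC_of_injective _ E _) (ih _
          (hX.subsingleton_shift' b (subsingleton_HC_of_injective _ E _) h1)
          (hX.subsingleton_shift' b (subsingleton_HC_of_injective _ E _) h2))
    intro X _ _
    obtain ⟨k, rfl⟩ : ∃ k, i = k + 2 := ⟨i - 2, by omega⟩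
    exact key k X (hr _ (by omega) X) (hr _ (by omega) X)

end Noetherian

section TopDegree
open TensorProduct

lemma HCmap_sum {A B : Type u} [AddCommGroup A] [Module R A] [AddCommGroup B] [Module R B]
    (i : ℕ) {ι : Type*} (s : Finset ι) (f : ι → A →ₗ[R] B) (x : HC a i A) :
    HCmap a i (∑ j ∈ s, f j) x = ∑ j ∈ s, HCmap a i (f j) x := by
  classical
  induction s using Finset.induction_on with
  | empty => simp [HCmap_zero]
  | insert j s hj ih => rw [Finset.sum_insert hj, HCmap_add, ih, Finset.sum_insert hj]

lemma sum_single_comp_proj (m : ℕ) :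
    (∑ j : Fin m, LinearMap.toSpanSingleton R (Fin m → R) (Pi.single j 1) ∘ₗ LinearMap.proj j) =
      (LinearMap.id : (Fin m → R) →ₗ[R] _) := by
  refine LinearMap.ext fun x => ?_
  ext i
  simp [Finset.sum_apply, Pi.single_apply]

lemma subsingleton_HC_pi {i : ℕ} (h : Subsingleton (HC a i R)) (m : ℕ) :
    Subsingleton (HC a i (Fin m → R)) := by
  refine subsingleton_of_forall_eq 0 fun x => ?_
  rw [← HCmap_id a i x, ← sum_single_comp_proj, HCmap_sum]
  refine Finset.sum_eq_zero fun j _ => ?_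
  rw [HCmap_comp, Subsingleton.elim (HCmap a i (LinearMap.proj j) x) 0, map_zero]

lemma exists_SES_pi [IsNoetherianRing R] (X : Type u) [AddCommGroup X] [Module R X]
    [Module.Finite R X] : ∃ (m : ℕ) (K : Type u) (_ : AddCommGroup K) (_ : Module R K)
      (f : K →ₗ[R] (Fin m → R)) (g : (Fin m → R) →ₗ[R] X), Module.Finite R K ∧ SES f g := by
  obtain ⟨m, g, hg⟩ := Module.Finite.exists_fin' R X
  exact ⟨m, LinearMap.ker g, inferInstance, inferInstance, _, g, inferInstance,
    SES.of_surjective hg⟩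

/-- If the ring has no local cohomology above degree `n`, neither do finite modules. -/
lemma subsingleton_HC_of_lt [IsNoetherianRing R] {n : ℕ}
    (h : ∀ i, n < i → Subsingleton (HC a i R)) (i : ℕ) (hi : n < i) (X : Type u) [AddCommGroup X]
    [Module R X] [Module.Finite R X] : Subsingleton (HC a i X) := by
  obtain ⟨r, hr⟩ := exists_cohomDim a
  have key : ∀ (k i : ℕ), n < i → r < i + k → ∀ (X : Type u) [AddCommGroup X] [Module R X]
      [Module.Finite R X], Subsingleton (HC a i X) := by
    intro k
    induction k with
    | zero => exact fun i _ hi X _ _ _ => hr i hi X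
    | succ k ih =>
      intro i hi hik X _ _ _
      obtain ⟨m, K, _, _, f, g, hK, hfg⟩ := exists_SES_pi (R := R) X
      exact hfg.subsingleton_shift' a (subsingleton_HC_pi a (h i hi) m)
        (ih (i + 1) (by omega) (by omega) K)
  exact key (r + 1) i hi (by omega) X

/-- The comparison map to local cohomology in degree `n`. -/
def theta (n : ℕ) (X : Type u) [AddCommGroup X] [Module R X] : HC a n R ⊗[R] X →ₗ[R] HC a n X :=
  TensorProduct.lift (LinearMap.mk₂ R
    (fun h x => HCmap a n (LinearMap.toSpanSingleton R X x) h)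
    (fun _ _ _ => map_add _ _ _) (fun _ _ _ => map_smul _ _ _)
    (fun h x y => by rw [LinearMap.toSpanSingleton_add, HCmap_add])
    (fun c h x => by rw [LinearMap.toSpanSingleton_smul, HCmap_smul]))

lemma theta_tmul (n : ℕ) {X : Type u} [AddCommGroup X] [Module R X] (h : HC a n R) (x : X) :
    theta a n X (h ⊗ₜ x) = HCmap a n (LinearMap.toSpanSingleton R X x) h := rfl

lemma theta_naturality (n : ℕ) {X Y : Type u} [AddCommGroup X] [Module R X] [AddCommGroup Y]
    [Module R Y] (f : X →ₗ[R] Y) (z : HC a n R ⊗[R] X) :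
    theta a n Y (f.lTensor _ z) = HCmap a n f (theta a n X z) := by
  induction z with
  | zero => simp
  | add x y hx hy => simp only [map_add, hx, hy]
  | tmul h x =>
    rw [LinearMap.lTensor_tmul, theta_tmul, theta_tmul, ← HCmap_comp,
      LinearMap.comp_toSpanSingleton]

lemma theta_pi_bijective (n m : ℕ) : Function.Bijective (theta a n (Fin m → R)) := by
  let inv : HC a n (Fin m → R) → HC a n R ⊗[R] (Fin m → R) := fun x =>
    ∑ j : Fin m, HCmap a n (LinearMap.proj j) x ⊗ₜ[R] (Pi.single j (1 : R) : Fin m → R)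
  refine Function.bijective_iff_has_inverse.2 ⟨inv, fun z => ?_, fun x => ?_⟩
  · induction z with
    | zero => simp [inv]
    | add x y hx hy =>
      simp only [inv, map_add, TensorProduct.add_tmul, Finset.sum_add_distrib] at hx hy ⊢
      exact congrArg₂ _ hx hy
    | tmul h x =>
      simp only [inv, theta_tmul, ← HCmap_comp]
      have : ∀ j : Fin m, (LinearMap.proj j ∘ₗ LinearMap.toSpanSingleton R (Fin m → R) x) =
          x j • (LinearMap.id : R →ₗ[R] R) := fun j => by
        ext; simp
      simp only [this, HCmap_smul, HCmap_id, TensorProduct.smul_tmul]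
      rw [← TensorProduct.tmul_sum]
      congr 1
      ext i
      simp [Pi.single_apply]
  · simp only [inv, map_sum, theta_tmul, ← HCmap_comp]
    rw [← HCmap_sum, sum_single_comp_proj, HCmap_id]

variable [IsNoetherianRing R]

/-- The comparison map is bijective on finite modules when `n` is the top degree. -/
lemma theta_bijective {n : ℕ} (h : ∀ i, n < i → Subsingleton (HC a i R)) (X : Type u)
    [AddCommGroup X] [Module R X] [Module.Finite R X] : Function.Bijective (theta a n X) := by
  have surj : ∀ (X : Type u) [AddCommGroup X] [Module R X] [Module.Finite R X],
      Function.Surjective (theta a n X) := by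
    intro X _ _ _ w
    obtain ⟨m, K, _, _, f, g, hK, hfg⟩ := exists_SES_pi (R := R) X
    have := subsingleton_HC_of_lt a h (n + 1) (by omega) K
    obtain ⟨v, rfl⟩ := (hfg.exact_right a n w).1 (Subsingleton.elim _ _)
    obtain ⟨z, rfl⟩ := (theta_pi_bijective a n m).2 v
    exact ⟨_, theta_naturality a n g z⟩
  refine ⟨(injective_iff_map_eq_zero _).2 fun z hz => ?_, surj X⟩
  obtain ⟨m, K, _, _, f, g, hK, hfg⟩ := exists_SES_pi (R := R) X
  obtain ⟨w, rfl⟩ := LinearMap.lTensor_surjective _ hfg.surj z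
  rw [theta_naturality] at hz
  obtain ⟨v, hv⟩ := (hfg.exact_mid a n _).1 hz
  obtain ⟨k, rfl⟩ := surj K v
  rw [← theta_naturality] at hv
  rw [← (theta_pi_bijective a n m).1 hv]
  exact (lTensor_exact (HC a n R) hfg.exact hfg.surj).apply_apply_eq_zero k

end TopDegree

/-- Kernels of isomorphic maps are isomorphic. -/
def kerCongr {A B A' B' : Type*} [AddCommGroup A] [Module R A] [AddCommGroup B] [Module R B]
    [AddCommGroup A'] [Module R A'] [AddCommGroup B'] [Module R B'] {f : A →ₗ[R] B}
    {f' : A' →ₗ[R] B'} (e : A ≃ₗ[R] A') (e' : B ≃ₗ[R] B') (h : ∀ x, e' (f x) = f' (e x)) :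
    LinearMap.ker f ≃ₗ[R] LinearMap.ker f' :=
  e.ofSubmodules _ _ (by
    ext y
    obtain ⟨x, rfl⟩ := e.surjective y
    simp [← h])

lemma subsingleton_HC_top (i : ℕ) : ∀ (X : Type u) [AddCommGroup X] [Module R X],
    Subsingleton (HC (⊤ : Ideal R) i X) := by
  induction i with
  | zero =>
    refine fun X _ _ => subsingleton_of_forall_eq 0 fun x => hev_injective _ ?_
    obtain ⟨s, hs⟩ := isTor_hev ⊤ x
    rw [map_zero, ← one_smul R (hev ⊤ X x)]
    exact hs 1 (by simp [Ideal.top_pow])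
  | succ i ih =>
    intro X _ _
    obtain ⟨E, _, _, f, hE, hf⟩ := exists_injective_embedding (R := R) X
    exact (SES.of_injective hf).subsingleton_shift _ (subsingleton_HC_of_injective _ E _) (ih _)

section Resolution
open TensorProduct

/-- Iterated syzygies `Y (j + 1) → P j → Y j`. -/
structure Syzygies (PF : ModuleCat.{u} R → Prop) (X : Type u) [AddCommGroup X] [Module R X] where
  Y : ℕ → ModuleCat.{u} R
  P : ℕ → ModuleCat.{u} R
  f : ∀ j, Y (j + 1) →ₗ[R] P j
  g : ∀ j, P j →ₗ[R] Y j
  ses : ∀ j, SES (f j) (g j)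
  prop : ∀ j, PF (P j)
  zero : Y 0 ≃ₗ[R] X

lemma exists_syzygies {PF : ModuleCat.{u} R → Prop} (Q : ModuleCat.{u} R → Prop)
    (h : ∀ X, Q X → ∃ (K P : ModuleCat.{u} R) (f : K →ₗ[R] P) (g : P →ₗ[R] X),
      Q K ∧ PF P ∧ SES f g) (X : Type u) [AddCommGroup X] [Module R X]
    (hX : Q (ModuleCat.of R X)) : ∃ S : Syzygies PF X, ∀ j, Q (S.Y j) := by
  choose K P f g hK hP hfg using h
  let Z : ℕ → {X : ModuleCat.{u} R // Q X} := fun j =>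
    j.rec ⟨_, hX⟩ fun _ X => ⟨K X.1 X.2, hK X.1 X.2⟩
  exact ⟨⟨fun j => (Z j).1, fun j => P (Z j).1 (Z j).2, fun j => f (Z j).1 (Z j).2,
    fun j => g (Z j).1 (Z j).2, fun j => hfg (Z j).1 (Z j).2, fun j => hP (Z j).1 (Z j).2,
    LinearEquiv.refl R X⟩, fun j => (Z j).2⟩

/-- Being isomorphic to a finite power of the ring. -/
def IsPi (P : ModuleCat.{u} R) : Prop := ∃ m : ℕ, Nonempty (P ≃ₗ[R] (Fin m → R))

lemma exists_syzygies_pi [IsNoetherianRing R] (X : Type u) [AddCommGroup X] [Module R X]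
    [Module.Finite R X] : ∃ S : Syzygies (R := R) IsPi X, ∀ j, Module.Finite R (S.Y j) := by
  refine exists_syzygies (fun Y => Module.Finite R Y) (fun Y hY => ?_) X ‹_›
  obtain ⟨m, K, _, _, f, g, hK, hfg⟩ := exists_SES_pi (R := R) Y
  exact ⟨ModuleCat.of R K, ModuleCat.of R (Fin m → R), f, g, hK, ⟨m, ⟨LinearEquiv.refl _ _⟩⟩, hfg⟩

variable {A B C : Type u} [AddCommGroup A] [Module R A] [AddCommGroup B] [Module R B]
  [AddCommGroup C] [Module R C] {f : A →ₗ[R] B} {g : B →ₗ[R] C}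

/-- The connecting map identifies a cohomology module with a kernel. -/
def SES.shiftKer (h : SES f g) {i : ℕ} (hB : Subsingleton (HC a i B)) :
    HC a i C ≃ₗ[R] LinearMap.ker (HCmap a (i + 1) f) :=
  LinearEquiv.ofInjective (h.dlt a i) ((injective_iff_map_eq_zero _).2 fun z hz => by
    obtain ⟨y, rfl⟩ := (h.exact_right a i z).1 hz
    rw [Subsingleton.elim y 0, map_zero]) ≪≫ₗ
  LinearEquiv.ofEq _ _ (h.exact_left a i).linearMap_ker_eq.symm

def SES.shift (h : SES f g) {i : ℕ} (hB : Subsingleton (HC a i B))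
    (hB' : Subsingleton (HC a (i + 1) B)) : HC a i C ≃ₗ[R] HC a (i + 1) A :=
  h.shiftKer a hB ≪≫ₗ LinearEquiv.ofTop _
    (eq_top_iff.2 fun _ _ => LinearMap.mem_ker.2 (Subsingleton.elim _ _))

lemma subsingleton_HC_isPi {i : ℕ} (h : Subsingleton (HC a i R)) {P : ModuleCat.{u} R}
    (hP : IsPi P) : Subsingleton (HC a i P) := by
  obtain ⟨m, ⟨e⟩⟩ := hP
  have := subsingleton_HC_pi a h m
  exact (LCequiv a i (X := ModuleCat.of R P) (Y := ModuleCat.of R (Fin m → R))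
    e).toEquiv.subsingleton

/-- Zeroth local cohomology of a torsion module. -/
def hevEquiv (h : ∀ x : A, IsTor a x) : HC a 0 A ≃ₗ[R] A :=
  LinearEquiv.ofBijective (hev a A) ⟨hev_injective a, fun x => exists_hev a (h x)⟩

variable {n : ℕ} {X : Type u} [AddCommGroup X] [Module R X]

lemma Syzygies.nonempty_shift (S : Syzygies (R := R) IsPi X)
    (h : ∀ i, i ≠ n → Subsingleton (HC a i R))
    (i j : ℕ) (hij : i + j < n) : Nonempty (HC a (i + j) (S.Y j) ≃ₗ[R] HC a i X) := by
  induction j with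
  | zero => exact ⟨LCequiv a i (X := S.Y 0) (Y := ModuleCat.of R X) S.zero⟩
  | succ j ih =>
    obtain ⟨e⟩ := ih (by omega)
    exact ⟨((S.ses j).shift a (subsingleton_HC_isPi a (h (i + j) (by omega)) (S.prop j))
      (subsingleton_HC_isPi a (h (i + j + 1) (by omega)) (S.prop j))).symm ≪≫ₗ e⟩

variable [IsNoetherianRing R]

lemma nonempty_tensor_equiv_of_isTor [Module.Finite R X] (h : ∀ i, i ≠ 0 → Subsingleton (HC a i R))
    (hX : ∀ x : X, IsTor a x) : Nonempty ((HC a 0 R ⊗[R] X) ≃ₗ[R] X) :=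
  ⟨LinearEquiv.ofBijective _ (theta_bijective a (fun i hi => h i (by omega)) X) ≪≫ₗ
    hevEquiv a hX⟩

lemma subsingleton_tensor_of_isTor [Module.Finite R X]
    (h : ∀ i, i ≠ n + 1 → Subsingleton (HC a i R))
    (hX : ∀ x : X, IsTor a x) : Subsingleton (HC a (n + 1) R ⊗[R] X) := by
  have := subsingleton_HC_of_isTor a n X hX
  exact (theta_bijective a (fun i hi => h i (by omega)) X).1.subsingleton

lemma Syzygies.nonempty_ker_equiv (S : Syzygies (R := R) IsPi X) (hS : ∀ j, Module.Finite R (S.Y j))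
    (h : ∀ i, i ≠ n + 1 → Subsingleton (HC a i R)) (i j : ℕ) (hij : i + j = n) :
    Nonempty (LinearMap.ker ((S.f j).lTensor (HC a (n + 1) R)) ≃ₗ[R] HC a i X) := by
  subst hij
  obtain ⟨e⟩ := S.nonempty_shift a h i j (by omega)
  have hfin : Module.Finite R (S.P j) := by
    obtain ⟨m, ⟨e⟩⟩ := S.prop j
    exact Module.Finite.equiv e.symm
  have := hS (j + 1)
  have hb := fun (Z : Type u) [AddCommGroup Z] [Module R Z] [Module.Finite R Z] =>
    theta_bijective a (n := i + j + 1) (fun i hi => h i (by omega)) Z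
  exact ⟨kerCongr (LinearEquiv.ofBijective _ (hb (S.Y (j + 1))))
    (LinearEquiv.ofBijective _ (hb (S.P j))) (theta_naturality a _ (S.f j)) ≪≫ₗ
    ((S.ses j).shiftKer a
      (subsingleton_HC_isPi a (h (i + j) (by omega)) (S.prop j))).symm ≪≫ₗ e⟩

end Resolution

section Gruson
open TensorProduct
variable {M X : Type u} [AddCommGroup M] [Module R M] [AddCommGroup X] [Module R X]

lemma smul_mem_of_subsingleton_tensor [Subsingleton (M ⊗[R] X)] (K : Submodule R M) (m : M) {r : R}
    (hr : ∀ x : M, r • x ∈ K ⊔ Submodule.span R {m}) (z : X) :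
    r • z ∈ (LinearMap.ker (LinearMap.toSpanSingleton R (M ⧸ K) (K.mkQ m)) : Ideal R) •
      (⊤ : Submodule R X) := by
  set q := LinearMap.toSpanSingleton R (M ⧸ K) (K.mkQ m) with hq
  have hmem : ∀ x : M, (r • K.mkQ) x ∈ LinearMap.range q := fun x => by
    obtain ⟨k, hk, y, hy, hxy⟩ := Submodule.mem_sup.1 (hr x)
    obtain ⟨c, rfl⟩ := Submodule.mem_span_singleton.1 hy
    refine ⟨c, ?_⟩
    rw [LinearMap.smul_apply, ← map_smul, ← hxy, map_add,
      (Submodule.Quotient.mk_eq_zero K).2 hk |> (fun h => (h : K.mkQ k = 0)), zero_add, map_smul]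
    rfl
  let ψ : M →ₗ[R] R ⧸ LinearMap.ker q :=
    q.quotKerEquivRange.symm.toLinearMap ∘ₗ (r • K.mkQ).codRestrict _ hmem
  have hψ : ψ m = Ideal.Quotient.mk (LinearMap.ker q) r := by
    refine q.quotKerEquivRange.symm_apply_eq.2 (Subtype.ext ?_)
    rfl
  have h0 := congrArg (TensorProduct.quotTensorEquivQuotSMul X (LinearMap.ker q : Ideal R))
    (congrArg (ψ.rTensor X) (Subsingleton.elim (m ⊗ₜ[R] z) 0))
  rw [LinearMap.rTensor_tmul, hψ, map_zero, map_zero,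
    TensorProduct.quotTensorEquivQuotSMul_mk_tmul, Submodule.Quotient.mk_eq_zero] at h0
  exact h0

lemma annihilator_smul_top_of_subsingleton_tensor [Subsingleton (M ⊗[R] X)] (S : Finset M) :
    ∀ K : Submodule R M, K ⊔ Submodule.span R (S : Set M) = ⊤ →
      Module.annihilator R (M ⧸ K) • (⊤ : Submodule R X) = ⊤ := by
  classical
  induction S using Finset.induction_on with
  | empty =>
    intro K hK
    obtain rfl : K = ⊤ := by simpa using hK
    have : Module.annihilator R (M ⧸ (⊤ : Submodule R M)) = ⊤ :=
      Module.annihilator_eq_top_iff.2 inferInstance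
    rw [this, Submodule.top_smul]
  | insert m S _ ih =>
    intro K hK
    set K₁ := K ⊔ Submodule.span R {m} with hK₁
    have h1 := ih K₁ (by
      rw [← hK, Finset.coe_insert, Submodule.span_insert, hK₁, sup_assoc])
    set b : Ideal R := LinearMap.ker (LinearMap.toSpanSingleton R (M ⧸ K) (K.mkQ m)) with hb
    have hmem : ∀ r ∈ Module.annihilator R (M ⧸ K₁), ∀ x : M, r • x ∈ K₁ := fun r hr x =>
      (Submodule.Quotient.mk_eq_zero K₁).1 (Module.mem_annihilator.1 hr (Submodule.Quotient.mk x))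
    have h2 : b • (⊤ : Submodule R X) = ⊤ := by
      refine top_le_iff.1 (h1.symm.le.trans (Submodule.smul_le.2 ?_))
      exact fun r hr z _ => smul_mem_of_subsingleton_tensor K m (hmem r hr) z
    rw [eq_top_iff]
    nth_rw 1 [← h1]
    nth_rw 1 [← h2]
    rw [← Submodule.mul_smul]
    refine Submodule.smul_mono (Ideal.mul_le.2 fun r hr s hs => Module.mem_annihilator.2 ?_) le_rfl
    refine fun x => Submodule.Quotient.induction_on _ x fun x => ?_
    refine (Submodule.Quotient.mk_eq_zero K).2 ?_
    obtain ⟨k, hk, y, hy, hxy⟩ := Submodule.mem_sup.1 (hmem r hr x)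
    obtain ⟨c, rfl⟩ := Submodule.mem_span_singleton.1 hy
    have hsm : s • m ∈ K := (Submodule.Quotient.mk_eq_zero K).1 hs
    change (r * s) • x ∈ K
    rw [mul_comm, mul_smul, ← hxy, smul_add, smul_comm s c]
    exact K.add_mem (K.smul_mem _ hk) (K.smul_mem _ hsm)

/-- A finite faithful module tensors nonzero modules to nonzero modules. -/
lemma subsingleton_of_subsingleton_tensor [Module.Finite R M] [Subsingleton (M ⊗[R] X)]
    (hM : Module.annihilator R M = ⊥) : Subsingleton X := by
  obtain ⟨S, hS⟩ := (Module.Finite.fg_top : (⊤ : Submodule R M).FG)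
  have h := annihilator_smul_top_of_subsingleton_tensor (R := R) (X := X) S ⊥
    (by rw [bot_sup_eq, hS])
  rw [(Submodule.quotEquivOfEqBot (⊥ : Submodule R M) rfl).annihilator_eq, hM,
    Submodule.bot_smul] at h
  exact Submodule.subsingleton_iff R |>.1 (subsingleton_of_bot_eq_top h)

end Gruson

section TorVanishing
open TensorProduct

/-- Flatness as a predicate on bundled modules. -/
def IsFl (P : ModuleCat.{u} R) : Prop := Module.Flat R P

lemma lTensor_injective_of_SES {A F M Z' Z Z'' : Type u} [AddCommGroup A] [Module R A]
    [AddCommGroup F] [Module R F] [AddCommGroup M] [Module R M] [AddCommGroup Z'] [Module R Z']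
    [AddCommGroup Z] [Module R Z] [AddCommGroup Z''] [Module R Z''] {f : A →ₗ[R] F} {g : F →ₗ[R] M}
    {p : Z' →ₗ[R] Z} {v : Z →ₗ[R] Z''} (h : SES f g) (h' : SES p v)
    (hf : Function.Injective (f.rTensor Z'')) (hF : Function.Injective (p.lTensor F)) :
    Function.Injective (p.lTensor M) := by
  refine (injective_iff_map_eq_zero _).2 fun x hx => ?_
  obtain ⟨y, rfl⟩ := LinearMap.rTensor_surjective Z' h.surj x
  have h1 : g.rTensor Z (p.lTensor F y) = 0 := by
    rw [← hx, ← LinearMap.comp_apply, ← LinearMap.comp_apply, LinearMap.rTensor_comp_lTensor,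
      LinearMap.lTensor_comp_rTensor]
  obtain ⟨w, hw⟩ := (rTensor_exact Z h.exact h.surj _).1 h1
  have h2 : v.lTensor A w = 0 := by
    apply hf
    rw [map_zero, ← LinearMap.comp_apply, LinearMap.rTensor_comp_lTensor,
      ← LinearMap.lTensor_comp_rTensor, LinearMap.comp_apply, hw]
    exact (lTensor_exact F h'.exact h'.surj).apply_apply_eq_zero y
  obtain ⟨w', rfl⟩ := (lTensor_exact A h'.exact h'.surj _).1 h2
  have h3 : f.rTensor Z' w' = y := by
    apply hF
    rw [← hw, ← LinearMap.comp_apply, ← LinearMap.comp_apply, LinearMap.rTensor_comp_lTensor,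
      LinearMap.lTensor_comp_rTensor]
  rw [← h3]
  exact (rTensor_exact Z' h.exact h.surj).apply_apply_eq_zero w'

variable {M : Type u} [AddCommGroup M] [Module R M]

/-- Vanishing of all positive Tor modules against `Z`, in terms of flat syzygies of `M`. -/
def Syzygies.TorVan (S : Syzygies (R := R) IsFl M) (Z : Type u) [AddCommGroup Z] [Module R Z] :
    Prop :=
  ∀ j, Function.Injective ((S.f j).rTensor Z)

variable {S : Syzygies (R := R) IsFl M} {Z' Z Z'' : Type u} [AddCommGroup Z'] [Module R Z']
    [AddCommGroup Z] [Module R Z] [AddCommGroup Z''] [Module R Z''] {p : Z' →ₗ[R] Z}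
    {v : Z →ₗ[R] Z''}

lemma Syzygies.TorVan.lTensor_Y (hZ : S.TorVan Z'') (h : SES p v) (j : ℕ) :
    Function.Injective (p.lTensor (S.Y j)) := by
  have : Module.Flat R (S.P j) := S.prop j
  exact lTensor_injective_of_SES (S.ses j) h (hZ j)
    (Module.Flat.lTensor_preserves_injective_linearMap p h.inj)

lemma Syzygies.TorVan.lTensor (hZ : S.TorVan Z'') (h : SES p v) :
    Function.Injective (p.lTensor M) := by
  have h0 := hZ.lTensor_Y h 0
  have h1 : p.lTensor M = (S.zero.rTensor Z).toLinearMap ∘ₗ p.lTensor (S.Y 0) ∘ₗ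
      (S.zero.rTensor Z').symm.toLinearMap := by
    ext m z
    simp
  rw [h1]
  exact (S.zero.rTensor Z).injective.comp (h0.comp (S.zero.rTensor Z').symm.injective)

lemma Syzygies.TorVan.of_SES (hZ : S.TorVan Z) (hZ'' : S.TorVan Z'') (h : SES p v) :
    S.TorVan Z' := by
  intro j
  have h1 : (p.lTensor (S.P j)) ∘ₗ ((S.f j).rTensor Z') =
      ((S.f j).rTensor Z) ∘ₗ (p.lTensor (S.Y (j + 1))) := by
    rw [LinearMap.rTensor_comp_lTensor, LinearMap.lTensor_comp_rTensor]
  refine Function.Injective.of_comp (f := p.lTensor (S.P j)) ?_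
  rw [← LinearMap.coe_comp, h1]
  exact (hZ j).comp (hZ''.lTensor_Y h (j + 1))

lemma Syzygies.TorVan.of_equiv (hZ : S.TorVan Z) (e : Z' ≃ₗ[R] Z) : S.TorVan Z' := by
  intro j
  have h1 : (e.toLinearMap.lTensor (S.P j)) ∘ₗ ((S.f j).rTensor Z') =
      ((S.f j).rTensor Z) ∘ₗ (e.toLinearMap.lTensor (S.Y (j + 1))) := by
    rw [LinearMap.rTensor_comp_lTensor, LinearMap.lTensor_comp_rTensor]
  refine Function.Injective.of_comp (f := e.toLinearMap.lTensor (S.P j)) ?_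
  rw [← LinearMap.coe_comp, h1]
  exact (hZ j).comp (e.lTensor (S.Y (j + 1))).injective

lemma Syzygies.torVan_of_subsingleton [Subsingleton Z] : S.TorVan Z := fun _ =>
  Function.injective_of_subsingleton _

lemma Syzygies.TorVan.tensor_flat (hZ : S.TorVan Z) (P : Type u) [AddCommGroup P] [Module R P]
    [Module.Flat R P] : S.TorVan (Z ⊗[R] P) := by
  intro j
  rw [LinearMap.rTensor_tensor]
  exact (TensorProduct.assoc R _ _ _).injective.comp
    ((Module.Flat.rTensor_preserves_injective_linearMap _ (hZ j)).comp
      (TensorProduct.assoc R _ _ _).symm.injective)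

variable {N A P Y : Type u} [AddCommGroup N] [Module R N] [AddCommGroup A] [Module R A]
  [AddCommGroup P] [Module R P] [AddCommGroup Y] [Module R Y] {f : A →ₗ[R] P} {g : P →ₗ[R] Y}

lemma SES.range_lTensor (h : SES f g) (N : Type u) [AddCommGroup N] [Module R N] :
    SES (LinearMap.range (f.lTensor N)).subtype (g.lTensor N) where
  inj := Subtype.val_injective
  exact := by
    intro y
    rw [lTensor_exact N h.exact h.surj y]
    simp
  surj := LinearMap.lTensor_surjective N h.surj

lemma SES.rangeRestrict (φ : A →ₗ[R] P) : SES (LinearMap.ker φ).subtype φ.rangeRestrict where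
  inj := Subtype.val_injective
  exact := by
    intro y
    simp [Subtype.ext_iff]
  surj := φ.surjective_rangeRestrict

lemma Syzygies.TorVan.range_lTensor (hN : S.TorVan N) (h : SES f g) [Module.Flat R P]
    (hY : S.TorVan (N ⊗[R] Y)) : S.TorVan (LinearMap.range (f.lTensor N)) :=
  (hN.tensor_flat P).of_SES hY (h.range_lTensor N)

lemma Syzygies.TorVan.succ (hN : S.TorVan N) (h : SES f g) [Module.Flat R P]
    (hY : S.TorVan (N ⊗[R] Y)) (hf : Function.Injective (f.lTensor N)) : S.TorVan (N ⊗[R] A) :=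
  (hN.range_lTensor h hY).of_equiv (LinearEquiv.ofInjective _ hf)

/-- Tensoring with `M` commutes with the formation of the kernel of `N ⊗ A → N ⊗ P`. -/
lemma Syzygies.TorVan.nonempty_ker_equiv (hN : S.TorVan N) (h : SES f g) [Module.Flat R P]
    (hY : S.TorVan (N ⊗[R] Y)) :
    Nonempty ((M ⊗[R] LinearMap.ker (f.lTensor N)) ≃ₗ[R]
      LinearMap.ker ((f.lTensor N).lTensor M)) := by
  have hI := hY.lTensor (h.range_lTensor N)
  have hK := (hN.range_lTensor h hY).lTensor (SES.rangeRestrict (f.lTensor N))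
  refine ⟨LinearEquiv.ofInjective _ hK ≪≫ₗ LinearEquiv.ofEq _ _ ?_⟩
  have h1 := lTensor_exact M (SES.rangeRestrict (f.lTensor N)).exact
    (SES.rangeRestrict (f.lTensor N)).surj
  rw [← h1.linearMap_ker_eq]
  have h2 : (f.lTensor N).lTensor M = ((LinearMap.range (f.lTensor N)).subtype.lTensor M) ∘ₗ
      ((f.lTensor N).rangeRestrict.lTensor M) := by
    rw [← LinearMap.lTensor_comp, LinearMap.subtype_comp_codRestrict]
  rw [h2, LinearMap.ker_comp_of_ker_eq_bot _ (LinearMap.ker_eq_bot.2 hI)]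

lemma nonempty_ker_assoc {H : Type u} [AddCommGroup H] [Module R H] (e : (M ⊗[R] N) ≃ₗ[R] H)
    (f : A →ₗ[R] P) :
    Nonempty (LinearMap.ker ((f.lTensor N).lTensor M) ≃ₗ[R] LinearMap.ker (f.lTensor H)) := by
  refine ⟨kerCongr ((TensorProduct.assoc R M N A).symm ≪≫ₗ e.rTensor A)
    ((TensorProduct.assoc R M N P).symm ≪≫ₗ e.rTensor P) fun x => ?_⟩
  refine LinearMap.congr_fun (f := (((TensorProduct.assoc R M N P).symm ≪≫ₗ
    e.rTensor P).toLinearMap ∘ₗ (f.lTensor N).lTensor M)) (g := (f.lTensor H) ∘ₗ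
    ((TensorProduct.assoc R M N A).symm ≪≫ₗ e.rTensor A).toLinearMap) ?_ x
  ext m n a
  simp

variable {X H : Type u} [AddCommGroup X] [Module R X] [AddCommGroup H] [Module R H]

lemma Syzygies.TorVan.nonempty_tensor_ker [Module.Finite R M] (hM : Module.annihilator R M = ⊥)
    (hN : S.TorVan N) (e : (M ⊗[R] N) ≃ₗ[R] H) (T : Syzygies (R := R) IsFl X) (k : ℕ)
    (h0 : Subsingleton (H ⊗[R] X))
    (hk : ∀ j < k, Subsingleton (LinearMap.ker ((T.f j).lTensor H))) :
    Nonempty ((M ⊗[R] LinearMap.ker ((T.f k).lTensor N)) ≃ₗ[R]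
      LinearMap.ker ((T.f k).lTensor H)) := by
  have key : ∀ j ≤ k, S.TorVan (N ⊗[R] T.Y j) := by
    intro j
    induction j with
    | zero =>
      intro _
      have : Subsingleton (M ⊗[R] (N ⊗[R] T.Y 0)) :=
        ((TensorProduct.assoc R M N (T.Y 0)).symm ≪≫ₗ
          TensorProduct.congr e T.zero).toEquiv.subsingleton
      have := subsingleton_of_subsingleton_tensor (X := N ⊗[R] T.Y 0) hM
      exact Syzygies.torVan_of_subsingleton
    | succ j ih =>
      intro hj
      have : Module.Flat R (T.P j) := T.prop j
      have hY := ih (by omega)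
      obtain ⟨e₁⟩ := hN.nonempty_ker_equiv (T.ses j) hY
      obtain ⟨e₂⟩ := nonempty_ker_assoc e (T.f j)
      have := hk j (by omega)
      have : Subsingleton (M ⊗[R] LinearMap.ker ((T.f j).lTensor N)) :=
        (e₁ ≪≫ₗ e₂).toEquiv.subsingleton
      have := subsingleton_of_subsingleton_tensor (X := LinearMap.ker ((T.f j).lTensor N)) hM
      refine hN.succ (T.ses j) hY (LinearMap.ker_eq_bot.1 ?_)
      exact Submodule.eq_bot_of_subsingleton
  have : Module.Flat R (T.P k) := T.prop k
  obtain ⟨e₁⟩ := hN.nonempty_ker_equiv (T.ses k) (key k le_rfl)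
  obtain ⟨e₂⟩ := nonempty_ker_assoc e (T.f k)
  exact ⟨e₁ ≪≫ₗ e₂⟩

end TorVanishing

section Tor
open TensorProduct MonoidalCategory

lemma subsingleton_Tor_iff {N : ModuleCat.{u} R} (Q : ProjectiveResolution N)
    (M : ModuleCat.{u} R) (i : ℕ) :
    Subsingleton (((Tor (ModuleCat.{u} R) (i + 1)).obj M).obj N) ↔
      Function.Exact ((Q.complex.d (i + 2) (i + 1)).hom.lTensor M)
        ((Q.complex.d (i + 1) i).hom.lTensor M) := by
  let F := (tensoringLeft (ModuleCat.{u} R)).obj M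
  let K := (F.mapHomologicalComplex (ComplexShape.down ℕ)).obj Q.complex
  have h1 : Subsingleton (((Tor (ModuleCat.{u} R) (i + 1)).obj M).obj N) ↔ K.ExactAt (i + 1) := by
    rw [HomologicalComplex.exactAt_iff_isZero_homology, ← ModuleCat.isZero_iff_subsingleton]
    exact (Q.isoLeftDerivedObj F (i + 1)).isZero_iff
  rw [h1, K.exactAt_iff' (i + 2) (i + 1) i (by simp) (by simp),
    ShortComplex.ShortExact.moduleCat_exact_iff_function_exact]
  rfl

lemma exact_d {N : ModuleCat.{u} R} (Q : ProjectiveResolution N) (i : ℕ) :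
    Function.Exact (Q.complex.d (i + 2) (i + 1)).hom (Q.complex.d (i + 1) i).hom :=
  (ShortComplex.ShortExact.moduleCat_exact_iff_function_exact _).1 (Q.exact_succ i)

lemma subsingleton_Tor_of_flat (M N : ModuleCat.{u} R) [Module.Flat R M] (i : ℕ) :
    Subsingleton (((Tor (ModuleCat.{u} R) (i + 1)).obj M).obj N) := by
  let Q : ProjectiveResolution N := projectiveResolution N
  exact (subsingleton_Tor_iff Q M i).2 (Module.Flat.lTensor_exact M (exact_d Q i))

/-- The syzygies of a projective resolution. -/
def syzygiesOfResolution {N : ModuleCat.{u} R} (Q : ProjectiveResolution N) :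
    Syzygies (R := R) IsFl N where
  Y j := ModuleCat.of R (Q.complex.X j ⧸ LinearMap.range (Q.complex.d (j + 1) j).hom)
  P j := Q.complex.X j
  f j := (LinearMap.range (Q.complex.d (j + 2) (j + 1)).hom).liftQ (Q.complex.d (j + 1) j).hom
    (exact_d Q j).linearMap_ker_eq.ge
  g j := (LinearMap.range (Q.complex.d (j + 1) j).hom).mkQ
  ses j := by
    refine ⟨?_, ?_, Submodule.mkQ_surjective _⟩
    · exact LinearMap.ker_eq_bot.1 (Submodule.ker_liftQ_eq_bot _ _ _
        (exact_d Q j).linearMap_ker_eq.le)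
    · rw [LinearMap.exact_iff, Submodule.ker_mkQ]
      exact (Submodule.range_liftQ _ _ _).symm
  prop j := by
    have := Q.projective j
    have : Module.Projective R (Q.complex.X j) :=
      (IsProjective.iff_projective (Q.complex.X j)).2 inferInstance
    exact Module.Flat.of_projective
  zero := Submodule.quotEquivOfEq _ _ (((ShortComplex.ShortExact.moduleCat_exact_iff_function_exact _).1
      Q.exact₀).linearMap_ker_eq).symm ≪≫ₗ
    LinearMap.quotKerEquivOfSurjective (Q.π.f 0).hom
      ((ModuleCat.epi_iff_surjective _).1 inferInstance)

lemma syzygiesOfResolution_injective {N : ModuleCat.{u} R} (Q : ProjectiveResolution N)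
    (M : ModuleCat.{u} R)
    (h : ∀ i, 1 ≤ i → Subsingleton (((Tor (ModuleCat.{u} R) i).obj M).obj N)) (j : ℕ) :
    Function.Injective (((syzygiesOfResolution Q).f j).lTensor M) := by
  have hex := (subsingleton_Tor_iff Q M j).1 (h (j + 1) (by omega))
  refine (injective_iff_map_eq_zero _).2 fun z hz => ?_
  obtain ⟨w, rfl⟩ := LinearMap.lTensor_surjective M
    ((syzygiesOfResolution Q).ses (j + 1)).surj z
  have hfg : (syzygiesOfResolution Q).f j ∘ₗ (syzygiesOfResolution Q).g (j + 1) =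
      (Q.complex.d (j + 1) j).hom := Submodule.liftQ_mkQ _ _ _
  rw [← LinearMap.comp_apply, ← LinearMap.lTensor_comp, hfg] at hz
  obtain ⟨v, rfl⟩ := (hex w).1 hz
  have h0 : (syzygiesOfResolution Q).g (j + 1) ∘ₗ (Q.complex.d (j + 2) (j + 1)).hom = 0 :=
    LinearMap.range_mkQ_comp _
  have h1 : ((syzygiesOfResolution Q).g (j + 1)).lTensor M ∘ₗ
      (Q.complex.d (j + 2) (j + 1)).hom.lTensor M = 0 := by
    rw [← LinearMap.lTensor_zero M, ← h0]
    exact (LinearMap.lTensor_comp _ _ _).symm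
  exact LinearMap.congr_fun h1 v

lemma injective_rTensor_of_lTensor {A B M : Type u} [AddCommGroup A] [Module R A]
    [AddCommGroup B] [Module R B] [AddCommGroup M] [Module R M] {f : A →ₗ[R] B}
    (h : Function.Injective (f.lTensor M)) : Function.Injective (f.rTensor M) := by
  rwa [← LinearMap.lTensor_inj_iff_rTensor_inj]

/-- Vanishing of Tor can be tested on syzygies of either variable. -/
lemma torVan_of_injective_lTensor {M N : Type u} [AddCommGroup M] [Module R M] [AddCommGroup N]
    [Module R N] (S : Syzygies (R := R) IsFl M) (T : Syzygies (R := R) IsFl N)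
    (h : ∀ j, Function.Injective ((T.f j).lTensor M)) : S.TorVan N := by
  have step : ∀ i, (∀ j, Function.Injective ((T.f j).lTensor (S.Y i))) →
      ∀ j, Function.Injective ((S.f i).lTensor (T.Y j)) := fun i hi j => by
    have : Module.Flat R (T.P j) := T.prop j
    exact lTensor_injective_of_SES (T.ses j) (S.ses i) (injective_rTensor_of_lTensor (hi j))
      (Module.Flat.lTensor_preserves_injective_linearMap _ (S.ses i).inj)
  have key : ∀ i, ∀ j, Function.Injective ((T.f j).lTensor (S.Y i)) := by
    intro i
    induction i with
    | zero =>
      intro j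
      have h1 : (S.zero.toLinearMap.rTensor (T.P j)) ∘ₗ ((T.f j).lTensor (S.Y 0)) =
          ((T.f j).lTensor M) ∘ₗ (S.zero.toLinearMap.rTensor (T.Y (j + 1))) := by
        rw [LinearMap.rTensor_comp_lTensor, LinearMap.lTensor_comp_rTensor]
      refine Function.Injective.of_comp (f := S.zero.toLinearMap.rTensor (T.P j)) ?_
      rw [← LinearMap.coe_comp, h1]
      exact (h j).comp (S.zero.rTensor _).injective
    | succ i ih =>
      intro j
      have h1 : ((S.f i).rTensor (T.P j)) ∘ₗ ((T.f j).lTensor (S.Y (i + 1))) =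
          ((T.f j).lTensor (S.P i)) ∘ₗ ((S.f i).rTensor (T.Y (j + 1))) := by
        rw [LinearMap.rTensor_comp_lTensor, LinearMap.lTensor_comp_rTensor]
      have : Module.Flat R (S.P i) := S.prop i
      refine Function.Injective.of_comp (f := (S.f i).rTensor (T.P j)) ?_
      rw [← LinearMap.coe_comp, h1]
      exact (Module.Flat.lTensor_preserves_injective_linearMap _ (T.ses j).inj).comp
        (injective_rTensor_of_lTensor (step i ih (j + 1)))
  have h0 : S.TorVan (T.Y 0) := fun i => injective_rTensor_of_lTensor (step i (key i) 0)
  exact h0.of_equiv T.zero.symm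

lemma torVan_of_subsingleton_Tor {M N : ModuleCat.{u} R} (S : Syzygies (R := R) IsFl M)
    (h : ∀ i, 1 ≤ i → Subsingleton (((Tor (ModuleCat.{u} R) i).obj M).obj N)) : S.TorVan N :=
  torVan_of_injective_lTensor S (syzygiesOfResolution (projectiveResolution N))
    (syzygiesOfResolution_injective _ M h)

end Tor

section Main
open TensorProduct IsLocalRing

lemma exists_flat_syzygies (M : Type u) [AddCommGroup M] [Module R M] :
    Nonempty (Syzygies (R := R) IsFl M) := by
  obtain ⟨S, -⟩ := exists_syzygies (R := R) (PF := IsFl) (fun _ => True) (fun X _ =>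
    ⟨ModuleCat.of R (LinearMap.ker (Finsupp.linearCombination R (id : X → X))),
      ModuleCat.of R (X →₀ R), _, _, trivial, (inferInstance : Module.Flat R (X →₀ R)),
      SES.of_surjective (Finsupp.linearCombination_id_surjective R X)⟩) M trivial
  exact ⟨S⟩

/-- Syzygies by finite powers of the ring are flat syzygies. -/
def Syzygies.flat {X : Type u} [AddCommGroup X] [Module R X] (S : Syzygies (R := R) IsPi X) :
    Syzygies (R := R) IsFl X :=
  { S with
    prop := fun j => by
      obtain ⟨m, ⟨e⟩⟩ := S.prop j
      exact Module.Flat.of_linearEquiv e }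

section Local
variable [IsLocalRing R]

lemma le_maximalIdeal_of_nontrivial {n : ℕ} (h : Nontrivial (HC a n R)) : a ≤ maximalIdeal R := by
  refine IsLocalRing.le_maximalIdeal ?_
  rintro rfl
  have := subsingleton_HC_top (R := R) n R
  exact not_nontrivial (HC (⊤ : Ideal R) n R) h

variable {a} in
lemma isTor_quotient_pow (h : a ≤ maximalIdeal R) (t : ℕ)
    (x : R ⧸ maximalIdeal R ^ t) : IsTor a x := by
  obtain ⟨x, rfl⟩ := Ideal.Quotient.mk_surjective x
  refine ⟨t, fun r hr => ?_⟩
  rw [← Ideal.Quotient.mk_eq_mk, ← Submodule.Quotient.mk_smul]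
  exact (Submodule.Quotient.mk_eq_zero _).2 (Ideal.mul_mem_right _ _ (Ideal.pow_right_mono h t hr))

variable {M : Type u} [AddCommGroup M] [Module R M] [Module.Finite R M]

/-- If `M ⊗ L` is the residue field then `M` is cyclic. -/
lemma exists_span_eq_top {L : Type u} [AddCommGroup L] [Module R L]
    (e : (M ⊗[R] L) ≃ₗ[R] (R ⧸ maximalIdeal R)) : ∃ m : M, Submodule.span R {m} = ⊤ := by
  have hex : ∃ m l, e (m ⊗ₜ l) ≠ 0 := by
    by_contra! h
    have h0 : e.toLinearMap = 0 := by
      ext m l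
      exact h m l
    obtain ⟨z, hz⟩ := e.surjective 1
    exact one_ne_zero (hz.symm.trans (LinearMap.congr_fun h0 z))
  obtain ⟨m, l, hml⟩ := hex
  refine ⟨m, (eq_top_or_exists_le_coatom _).resolve_right ?_⟩
  rintro ⟨P, hP, hmP⟩
  obtain ⟨I, hI, ⟨q⟩⟩ := isSimpleModule_iff_quot_maximal.1 (isSimpleModule_iff_isCoatom.2 hP)
  obtain rfl := IsLocalRing.eq_maximalIdeal hI
  let f : M →ₗ[R] R ⧸ maximalIdeal R := q.toLinearMap ∘ₗ P.mkQ
  have hfm : f m = 0 := by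
    have : P.mkQ m = 0 := (Submodule.Quotient.mk_eq_zero P).2
      (hmP (Submodule.mem_span_singleton_self m))
    simp [f, this]
  let B : M ⊗[R] L →ₗ[R] R ⧸ maximalIdeal R := TensorProduct.lift
    ((LinearMap.mul R (R ⧸ maximalIdeal R)).compl₁₂ f (e.toLinearMap ∘ₗ TensorProduct.mk R M L m))
  have hB : ∀ z, B z = e z * B (e.symm 1) := fun z => by
    obtain ⟨c, hc⟩ := Ideal.Quotient.mk_surjective (e z)
    have hz : e z = c • (1 : R ⧸ maximalIdeal R) := by
      rw [← hc, Algebra.smul_def, mul_one]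
      rfl
    have hz' : z = c • e.symm 1 := by
      rw [← map_smul, ← hz, e.symm_apply_apply]
    rw [hz, smul_mul_assoc, one_mul, ← map_smul, ← hz']
  have hBt : ∀ x y, B (x ⊗ₜ y) = f x * e (m ⊗ₜ y) := fun x y => rfl
  have hβ : B (e.symm 1) = 0 := by
    have h1 := hB (m ⊗ₜ l)
    rw [hBt, hfm, zero_mul] at h1
    exact (mul_eq_zero.1 h1.symm).resolve_left hml
  have hf : Function.Surjective f := q.surjective.comp P.mkQ_surjective
  obtain ⟨x, hx⟩ := hf 1
  have h2 := hBt x l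
  rw [hB, hβ, mul_zero, hx, one_mul] at h2
  exact hml h2.symm

variable [IsNoetherianRing R]

lemma annihilator_HC_eq_bot {n : ℕ} (h : Nontrivial (HC a n R))
    (h' : ∀ i, i ≠ n → Subsingleton (HC a i R)) : Module.annihilator R (HC a n R) = ⊥ := by
  have ha := le_maximalIdeal_of_nontrivial a h
  rw [eq_bot_iff, ← Ideal.iInf_pow_eq_bot_of_isLocalRing (maximalIdeal R)
    (Ideal.IsPrime.ne_top'),
    le_iInf_iff]
  intro t r hr
  rw [Module.mem_annihilator] at hr
  have hr' : ∀ (X : Type u) [AddCommGroup X] [Module R X] (z : HC a n R ⊗[R] X), r • z = 0 := by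
    intro X _ _ z
    induction z with
    | zero => rw [smul_zero]
    | add x y hx hy => rw [smul_add, hx, hy, add_zero]
    | tmul x y => rw [TensorProduct.smul_tmul', hr, TensorProduct.zero_tmul]
  have hX := isTor_quotient_pow ha t
  suffices hs : ∀ x : R ⧸ maximalIdeal R ^ t, r • x = 0 by
    have h1 := hs (Ideal.Quotient.mk _ 1)
    rw [← Ideal.Quotient.mk_eq_mk, ← Submodule.Quotient.mk_smul, smul_eq_mul, mul_one] at h1
    exact (Submodule.Quotient.mk_eq_zero _).1 h1
  intro x
  cases n with
  | zero =>
    obtain ⟨e⟩ := nonempty_tensor_equiv_of_isTor a h' hX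
    obtain ⟨z, rfl⟩ := e.surjective x
    rw [← map_smul, hr', map_zero]
  | succ k =>
    obtain ⟨T, hT⟩ := exists_syzygies_pi (R := R) (R ⧸ maximalIdeal R ^ t)
    obtain ⟨e⟩ := T.nonempty_ker_equiv a hT h' 0 k (by omega)
    obtain ⟨z, rfl⟩ := (e ≪≫ₗ hevEquiv a hX).surjective x
    have hz : r • z = 0 := Subtype.ext (hr' _ z.1)
    rw [← map_smul, hz, map_zero]

/-- A finite module `M` such that `M ⊗ N` is the only nonzero local cohomology module of the ring,
with vanishing Tor, is free of rank one. -/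
lemma nonempty_equiv_of_tensor_equiv {n : ℕ} (h : Nontrivial (HC a n R))
    (h' : ∀ i, i ≠ n → Subsingleton (HC a i R)) {N : Type u} [AddCommGroup N] [Module R N]
    (e : (M ⊗[R] N) ≃ₗ[R] HC a n R)
    (hT : ∀ i, 1 ≤ i → Subsingleton
      (((Tor (ModuleCat.{u} R) i).obj (ModuleCat.of R M)).obj (ModuleCat.of R N))) :
    Nonempty (M ≃ₗ[R] R) := by
  have ha := le_maximalIdeal_of_nontrivial a h
  have hM : Module.annihilator R M = ⊥ := by
    rw [eq_bot_iff, ← annihilator_HC_eq_bot a h h']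
    intro r hr
    rw [Module.mem_annihilator] at hr ⊢
    intro x
    obtain ⟨z, rfl⟩ := e.surjective x
    rw [← map_smul]
    suffices hz : r • z = 0 by rw [hz, map_zero]
    induction z with
    | zero => rw [smul_zero]
    | add x y hx hy => rw [smul_add, hx, hy, add_zero]
    | tmul x y => rw [TensorProduct.smul_tmul', hr, TensorProduct.zero_tmul]
  have hX : ∀ x : R ⧸ maximalIdeal R, IsTor a x := fun x => by
    obtain ⟨x, rfl⟩ := Ideal.Quotient.mk_surjective x
    refine ⟨1, fun r hr => ?_⟩
    rw [pow_one] at hr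
    rw [← Ideal.Quotient.mk_eq_mk, ← Submodule.Quotient.mk_smul]
    exact (Submodule.Quotient.mk_eq_zero _).2 (Ideal.mul_mem_right _ _ (ha hr))
  obtain ⟨m, hm⟩ : ∃ m : M, Submodule.span R {m} = ⊤ := by
    cases n with
    | zero =>
      obtain ⟨e'⟩ := nonempty_tensor_equiv_of_isTor a h' hX
      exact exists_span_eq_top ((TensorProduct.assoc R M N _).symm ≪≫ₗ e.rTensor _ ≪≫ₗ e')
    | succ k =>
      obtain ⟨S⟩ := exists_flat_syzygies (R := R) M
      have hN : S.TorVan N := torVan_of_subsingleton_Tor (M := ModuleCat.of R M)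
        (N := ModuleCat.of R N) S hT
      obtain ⟨T, hT⟩ := exists_syzygies_pi (R := R) (R ⧸ maximalIdeal R)
      obtain ⟨e₁⟩ := T.nonempty_ker_equiv a hT h' 0 k (by omega)
      obtain ⟨e₂⟩ := hN.nonempty_tensor_ker hM e T.flat k (subsingleton_tensor_of_isTor a h' hX)
        fun j hj => by
          obtain ⟨i, rfl⟩ := Nat.exists_eq_add_of_lt hj
          obtain ⟨e₃⟩ := T.nonempty_ker_equiv a hT h' (i + 1) j (by omega)
          have := subsingleton_HC_of_isTor a i _ hX
          exact e₃.toEquiv.subsingleton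
      exact exists_span_eq_top (e₂ ≪≫ₗ e₁ ≪≫ₗ hevEquiv a hX)
  have hsurj : Function.Surjective (LinearMap.toSpanSingleton R M m) := by
    rw [← LinearMap.range_eq_top, LinearMap.range_toSpanSingleton, hm]
  refine ⟨(LinearEquiv.ofBijective (LinearMap.toSpanSingleton R M m)
    ⟨(injective_iff_map_eq_zero _).2 fun r hr => ?_, hsurj⟩).symm⟩
  rw [← Submodule.mem_bot R, ← hM, Module.mem_annihilator]
  intro x
  obtain ⟨c, rfl⟩ := hsurj x
  rw [LinearMap.toSpanSingleton_apply] at hr ⊢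
  rw [smul_comm, hr, smul_zero]

end Local

lemma nontrivial_HC_bot [Nontrivial R] : Nontrivial (HC (⊥ : Ideal R) 0 R) := by
  obtain ⟨z, hz⟩ := exists_hev (⊥ : Ideal R) (x := (1 : R)) ⟨1, fun r hr => by
    rw [pow_one] at hr
    rw [(Submodule.mem_bot R).1 hr, zero_smul]⟩
  refine ⟨z, 0, fun h0 => ?_⟩
  rw [h0, map_zero] at hz
  exact zero_ne_one hz

lemma subsingleton_HC_bot [IsNoetherianRing R] (i : ℕ) (hi : i ≠ 0) :
    Subsingleton (HC (⊥ : Ideal R) i R) := by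
  obtain ⟨j, rfl⟩ := Nat.exists_eq_succ_of_ne_zero hi
  refine subsingleton_HC_of_isTor _ j R fun x => ⟨1, fun r hr => ?_⟩
  rw [pow_one] at hr
  rw [(Submodule.mem_bot R).1 hr, zero_smul]

lemma bijective_lift_flip_of_equiv {M H : Type u} [AddCommGroup M] [Module R M] [AddCommGroup H]
    [Module R H] (e : M ≃ₗ[R] R) : Function.Bijective
      (TensorProduct.lift ((LinearMap.id : (M →ₗ[R] H) →ₗ[R] (M →ₗ[R] H)).flip)) := by
  have he : ∀ x y : M, e x • y = e y • x := fun x y => e.injective (by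
    rw [map_smul, map_smul, smul_eq_mul, smul_eq_mul, mul_comm])
  refine Function.bijective_iff_has_inverse.2
    ⟨fun h => e.symm 1 ⊗ₜ (LinearMap.toSpanSingleton R H h ∘ₗ e.toLinearMap), fun z => ?_,
      fun h => ?_⟩
  · induction z with
    | zero => simp
    | add x y hx hy =>
      simp only [map_add, LinearMap.toSpanSingleton_add, LinearMap.add_comp,
        TensorProduct.tmul_add] at hx hy ⊢
      rw [hx, hy]
    | tmul x f =>
      have h1 : LinearMap.toSpanSingleton R H (f x) ∘ₗ e.toLinearMap = e x • f := by
        refine LinearMap.ext fun y => ?_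
        change e y • f x = e x • f y
        rw [← map_smul, he y x, map_smul]
      have h2 : e x • e.symm 1 = x := by rw [he, e.apply_symm_apply, one_smul]
      simp only [TensorProduct.lift.tmul, LinearMap.flip_apply, LinearMap.id_apply, h1]
      rw [← TensorProduct.smul_tmul, h2]
  · simp

lemma subsingleton_Ext_of_projective (M N : ModuleCat.{u} R) [Module.Projective R M] (i : ℕ) :
    Subsingleton (((Ext R (ModuleCat.{u} R) (i + 1)).obj (op M)).obj N) := by
  have := (IsProjective.iff_projective M).1 ‹_›
  exact ModuleCat.subsingleton_of_isZero (isZero_Ext_succ_of_projective M N i)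

end Main

end LocalCoh

end

noncomputable section
open CategoryTheory TensorProduct

/-- Over a local ring with dualizing module `D`, for a semidualizing
module `C` set `C' = Hom_R(C,D)`.  Then `C' ≅ R` iff `H_a^{ht a}(R) ∈ B_{C'}(R)` for every
(equivalently, some) ideal `a` with respect to which `R` is relative Cohen-Macaulay. -/
theorem stmt_10 (R : Type u) [CommRing R] [IsNoetherianRing R] [IsLocalRing R]
    (D : ModuleCat.{u} R) (hD : IsDualizing R D)
    (C : ModuleCat.{u} R) (hC : IsSemidualizing R C) :
    (Nonempty ((↥C →ₗ[R] ↥D) ≃ₗ[R] R) ↔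
      ∀ (a : Ideal R) (n : ℕ), IsRelativeCMAt R a n (ModuleCat.of R R) →
        MemBassClass R (ModuleCat.of R (↥C →ₗ[R] ↥D))
          ((localCohomology a n).obj (ModuleCat.of R R))) ∧
    (Nonempty ((↥C →ₗ[R] ↥D) ≃ₗ[R] R) ↔
      ∃ (a : Ideal R) (n : ℕ), IsRelativeCMAt R a n (ModuleCat.of R R) ∧
        MemBassClass R (ModuleCat.of R (↥C →ₗ[R] ↥D))
          ((localCohomology a n).obj (ModuleCat.of R R))) := by
  have _ := hC.1
  have _ := hD.1.1
  have h₁₂ : Nonempty ((↥C →ₗ[R] ↥D) ≃ₗ[R] R) →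
      ∀ (a : Ideal R) (n : ℕ), IsRelativeCMAt R a n (ModuleCat.of R R) →
        MemBassClass R (ModuleCat.of R (↥C →ₗ[R] ↥D))
          ((localCohomology a n).obj (ModuleCat.of R R)) := by
    rintro ⟨e⟩ a n -
    have _ : Module.Projective R (ModuleCat.of R (↥C →ₗ[R] ↥D)) :=
      Module.Projective.of_equiv e.symm
    refine ⟨fun i hi => ?_, fun i hi => ?_, LocalCoh.bijective_lift_flip_of_equiv e⟩
    · obtain ⟨i, rfl⟩ := Nat.exists_eq_add_of_le' hi
      exact LocalCoh.subsingleton_Ext_of_projective _ _ i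
    · obtain ⟨i, rfl⟩ := Nat.exists_eq_add_of_le' hi
      exact LocalCoh.subsingleton_Tor_of_flat _ _ i
  have h₂₃ : (∀ (a : Ideal R) (n : ℕ), IsRelativeCMAt R a n (ModuleCat.of R R) →
        MemBassClass R (ModuleCat.of R (↥C →ₗ[R] ↥D))
          ((localCohomology a n).obj (ModuleCat.of R R))) →
      ∃ (a : Ideal R) (n : ℕ), IsRelativeCMAt R a n (ModuleCat.of R R) ∧
        MemBassClass R (ModuleCat.of R (↥C →ₗ[R] ↥D))
          ((localCohomology a n).obj (ModuleCat.of R R)) := fun h =>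
    have h₀ : IsRelativeCMAt R ⊥ 0 (ModuleCat.of R R) :=
      ⟨LocalCoh.nontrivial_HC_bot, fun i hi => LocalCoh.subsingleton_HC_bot i hi⟩
    ⟨⊥, 0, h₀, h ⊥ 0 h₀⟩
  have h₃₁ : (∃ (a : Ideal R) (n : ℕ), IsRelativeCMAt R a n (ModuleCat.of R R) ∧
        MemBassClass R (ModuleCat.of R (↥C →ₗ[R] ↥D))
          ((localCohomology a n).obj (ModuleCat.of R R))) →
      Nonempty ((↥C →ₗ[R] ↥D) ≃ₗ[R] R) := by
    rintro ⟨a, n, ⟨h, h'⟩, -, hTor, hbij⟩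
    exact LocalCoh.nonempty_equiv_of_tensor_equiv a h h' (LinearEquiv.ofBijective _ hbij) hTor
  exact ⟨⟨h₁₂, fun h => h₃₁ (h₂₃ h)⟩, ⟨fun h => h₂₃ (h₁₂ h), h₃₁⟩⟩

end
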